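/- arXiv:2509.15458 — 2 statements merged into one kernel-verified Lean document; each statement's English description precedes it below -/
import Mathlib

section
/- There exists a polynomial p such that for every (theta, pyramid)-free graph G, every cooperative set X in G, and every vertex b ∈ N(X), the number of neighbors of b in X satisfies |N(b) ∩ X| ≤ p(ω(G)). -/
open SimpleGraph

namespace Paper

variable {V : Type*}

/-- `S` is an independent (stable) set in `G`. -/
def IsIndep (G : SimpleGraph V) (S : Set V) : Prop :=
  ∀ ⦃a⦄, a ∈ S → ∀ ⦃b⦄, b ∈ S → a ≠ b → ¬ G.Adj a b

/-- The independence number of `S` is at most `k`. -/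
def IndepNumLE (G : SimpleGraph V) (S : Set V) (k : ℕ) : Prop :=
  ∀ T : Finset V, ↑T ⊆ S → IsIndep G ↑T → T.card ≤ k

/-- There are no edges between `A` and `B`. -/
def Anticomplete (G : SimpleGraph V) (A B : Set V) : Prop :=
  ∀ ⦃a⦄, a ∈ A → ∀ ⦃b⦄, b ∈ B → ¬ G.Adj a b

/-- `G` has no induced `K_{t,t}`. -/
def KttFree (G : SimpleGraph V) (t : ℕ) : Prop :=
  ¬ ∃ A B : Finset V, Disjoint A B ∧ A.card = t ∧ B.card = t ∧
      IsIndep G ↑A ∧ IsIndep G ↑B ∧ ∀ a ∈ A, ∀ b ∈ B, G.Adj a b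

/-- `P` is an induced path in `G`. -/
def IsInducedPathW (G : SimpleGraph V) {a b : V} (P : G.Walk a b) : Prop :=
  P.IsPath ∧ ∀ u ∈ P.support, ∀ v ∈ P.support, G.Adj u v → s(u, v) ∈ P.edges

/-- The interior of a path: its support minus the two ends. -/
def interiorSet (G : SimpleGraph V) {a b : V} (P : G.Walk a b) : Set V :=
  {v | v ∈ P.support ∧ v ≠ a ∧ v ≠ b}

/-- `G` contains a theta as an induced subgraph. -/
def ContainsTheta (G : SimpleGraph V) : Prop :=
  ∃ (a b : V) (P₁ P₂ P₃ : G.Walk a b),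
    a ≠ b ∧ ¬ G.Adj a b ∧
    IsInducedPathW G P₁ ∧ IsInducedPathW G P₂ ∧ IsInducedPathW G P₃ ∧
    2 ≤ P₁.length ∧ 2 ≤ P₂.length ∧ 2 ≤ P₃.length ∧
    Disjoint (interiorSet G P₁) (interiorSet G P₂) ∧
    Disjoint (interiorSet G P₁) (interiorSet G P₃) ∧
    Disjoint (interiorSet G P₂) (interiorSet G P₃) ∧
    Anticomplete G (interiorSet G P₁) (interiorSet G P₂) ∧
    Anticomplete G (interiorSet G P₁) (interiorSet G P₃) ∧
    Anticomplete G (interiorSet G P₂) (interiorSet G P₃)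

def ThetaFree (G : SimpleGraph V) : Prop := ¬ ContainsTheta G

/-- `G` contains a pyramid as an induced subgraph. -/
def ContainsPyramid (G : SimpleGraph V) : Prop :=
  ∃ (a : V) (b : Fin 3 → V) (P : ∀ i : Fin 3, G.Walk a (b i)),
    Function.Injective b ∧
    (∀ i j : Fin 3, i ≠ j → G.Adj (b i) (b j)) ∧
    (∀ i, IsInducedPathW G (P i)) ∧
    (∀ i, 1 ≤ (P i).length) ∧
    (∀ i j : Fin 3, i ≠ j → (P i).length = 1 → (P j).length ≠ 1) ∧
    (∀ i j : Fin 3, i ≠ j → ∀ v, v ∈ (P i).support → v ∈ (P j).support → v = a) ∧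
    (∀ i j : Fin 3, i ≠ j → ∀ u ∈ (P i).support, ∀ v ∈ (P j).support,
      u ≠ a → v ≠ a → G.Adj u v → u = b i ∧ v = b j)

def PyramidFree (G : SimpleGraph V) : Prop := ¬ ContainsPyramid G

/-- Open neighborhood of a set. -/
def nbhdS (G : SimpleGraph V) (X : Set V) : Set V := {v | v ∉ X ∧ ∃ x ∈ X, G.Adj x v}

/-- Closed neighborhood of a set. -/
def nbhdC (G : SimpleGraph V) (X : Set V) : Set V := X ∪ nbhdS G X

/-- The boundary of `X` inside the induced subgraph `G[U]`. -/
def delta1 (G : SimpleGraph V) (U X : Set V) : Set V :=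
  {v | v ∈ X ∧ ∃ u ∈ U \ X, G.Adj v u}

def delta2 (G : SimpleGraph V) (U X : Set V) : Set V := delta1 G U (X \ delta1 G U X)

/-- `S` induces a connected subgraph. -/
def ConnSet (G : SimpleGraph V) (S : Set V) : Prop := (G.induce S).Connected

/-- `X` is a cooperative set in the induced subgraph `G[U]`. -/
def Cooperative (G : SimpleGraph V) (U X : Set V) : Prop :=
  X ⊆ U ∧ ConnSet G X ∧
  (∀ v ∈ delta1 G U X, ∃ u ∈ X \ delta1 G U X, G.Adj v u) ∧
  (∀ v ∈ delta2 G U X, ∃ u ∈ X \ (delta1 G U X ∪ delta2 G U X), G.Adj v u) ∧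
  ConnSet G (X \ (delta1 G U X ∪ delta2 G U X))

/-- The finite set `A` is matched into `B` by a matching of `G`. -/
def MatchedInto (G : SimpleGraph V) (A : Finset V) (B : Set V) : Prop :=
  ∃ f : V → V, Set.InjOn f ↑A ∧ ∀ a ∈ A, f a ∈ B ∧ G.Adj a (f a)

/-- There are `|A|` paths from `A` to `b`, pairwise vertex-disjoint except at `b`,
internally disjoint from `N[X]`. -/
def LinkedTo (G : SimpleGraph V) (X : Set V) (A : Finset V) (b : V) : Prop :=
  ∃ P : ∀ a ∈ A, G.Walk a b,
    (∀ a (ha : a ∈ A), (P a ha).IsPath) ∧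
    (∀ a (ha : a ∈ A), ∀ v ∈ (P a ha).support, v ≠ a → v ≠ b → v ∉ nbhdC G X) ∧
    (∀ a (ha : a ∈ A), ∀ a' (ha' : a' ∈ A), a ≠ a' →
      ∀ v, v ∈ (P a ha).support → v ∈ (P a' ha').support → v = b)

/-- `(S, I)` is a matroid. -/
def IsMatroid [DecidableEq V] (S : Set V) (I : Set (Finset V)) : Prop :=
  (∅ ∈ I) ∧ (∀ A ∈ I, ↑A ⊆ S) ∧
  (∀ A B : Finset V, A ⊆ B → B ∈ I → A ∈ I) ∧
  (∀ A B : Finset V, A ∈ I → B ∈ I → A.card < B.card → ∃ x ∈ B, x ∉ A ∧ insert x A ∈ I)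

/-- `D` is a connected component of `G` minus the set `avoid`. -/
def IsCompAvoiding (G : SimpleGraph V) (avoid D : Set V) : Prop :=
  D ⊆ avoidᶜ ∧ ConnSet G D ∧ ∀ u, u ∉ D → u ∉ avoid → ¬ ∃ d ∈ D, G.Adj u d

/-- `Z` is a constricted set. -/
def Constricted (G : SimpleGraph V) (Z : Set V) : Prop :=
  IsIndep G Z ∧ ∀ S : Set V, (G.induce S).IsTree → (Z ∩ S).ncard ≤ 2

end Paper



namespace SNC

open Paper

/-- walk-connected set -/
def Conn {V : Type*} (G : SimpleGraph V) (S : Set V) : Prop :=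
  ∀ u ∈ S, ∀ v ∈ S, ∃ w : G.Walk u v, ∀ x ∈ w.support, x ∈ S

variable {V : Type*} {G : SimpleGraph V}

lemma conn_singleton (u : V) : Conn G {u} := by
  rintro x rfl y rfl
  exact ⟨Walk.nil, by simp⟩

lemma conn_insert {S : Set V} (hS : Conn G S) {u x : V} (hx : x ∈ S) (h : G.Adj u x) :
    Conn G (insert u S) := by
  rintro y hy z hz
  rcases hy with rfl | hy
  · rcases hz with rfl | hz
    · exact ⟨Walk.nil, by simp⟩
    · obtain ⟨w, hw⟩ := hS x hx z hz
      refine ⟨Walk.cons h w, ?_⟩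
      intro t ht
      rw [Walk.support_cons, List.mem_cons] at ht
      rcases ht with rfl | ht
      · exact Or.inl rfl
      · exact Or.inr (hw t ht)
  · rcases hz with rfl | hz
    · obtain ⟨w, hw⟩ := hS x hx y hy
      refine ⟨(Walk.cons h w).reverse, ?_⟩
      intro t ht
      rw [Walk.support_reverse, List.mem_reverse, Walk.support_cons, List.mem_cons] at ht
      rcases ht with rfl | ht
      · exact Or.inl rfl
      · exact Or.inr (hw t ht)
    · obtain ⟨w, hw⟩ := hS y hy z hz
      exact ⟨w, fun t ht => Or.inr (hw t ht)⟩

lemma conn_of_connSet {S : Set V} (h : ConnSet G S) : Conn G S := by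
  intro u hu v hv
  obtain ⟨w⟩ := h.preconnected ⟨u, hu⟩ ⟨v, hv⟩
  refine ⟨w.map (SimpleGraph.Embedding.induce S).toHom, ?_⟩
  intro x hx
  have hx' : x ∈ List.map (SimpleGraph.Embedding.induce (G := G) S).toHom w.support := by
    rw [← Walk.support_map]; exact hx
  obtain ⟨y, -, rfl⟩ := List.mem_map.1 hx'
  exact y.2

/-- shortest walk inside a set -/
lemma exists_shortest {S : Set V} {u v : V} (w : G.Walk u v) (hw : ∀ x ∈ w.support, x ∈ S) :
    ∃ P : G.Walk u v, (∀ x ∈ P.support, x ∈ S) ∧ P.IsPath ∧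
      ∀ i j, i < j → j ≤ P.length → G.Adj (P.getVert i) (P.getVert j) → j = i + 1 := by
  classical
  have hex : ∃ n, ∃ P : G.Walk u v, (∀ x ∈ P.support, x ∈ S) ∧ P.length = n :=
    ⟨_, w, hw, rfl⟩
  obtain ⟨P, hP, hn⟩ := Nat.find_spec hex
  have hmin : ∀ Q : G.Walk u v, (∀ x ∈ Q.support, x ∈ S) → P.length ≤ Q.length := by
    intro Q hQ
    rw [hn]
    exact Nat.find_min' hex ⟨Q, hQ, rfl⟩
  refine ⟨P, hP, ?_, ?_⟩
  · have h1 := hmin P.bypass (fun x hx => hP x (P.support_bypass_subset_support hx))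
    have := Walk.bypass_eq_self_of_length_le_length_bypass P h1
    rw [← this]
    exact P.bypass_isPath
  · intro i j hij hj hadj
    let Q := (P.take i).append (Walk.cons hadj (P.drop j))
    have hQ := hmin Q (by
      intro x hx
      apply hP
      simp only [Q, Walk.mem_support_append_iff, Walk.support_cons, List.mem_cons] at hx
      rcases hx with hx | rfl | hx
      · exact (P.isSubwalk_take i).support_subset hx
      · exact P.getVert_mem_support i
      · exact (P.isSubwalk_drop j).support_subset hx)
    simp only [Q, Walk.length_append, Walk.length_cons, Walk.take_length, Walk.drop_length] at hQ
    omega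

lemma induced_of {u v : V} {P : G.Walk u v} (h1 : P.IsPath)
    (h2 : ∀ i j, i < j → j ≤ P.length → G.Adj (P.getVert i) (P.getVert j) → j = i + 1) :
    IsInducedPathW G P := by
  refine ⟨h1, ?_⟩
  have key : ∀ i, i < P.length → s(P.getVert i, P.getVert (i+1)) ∈ P.edges := by
    intro i hi
    exact (Walk.mk_mem_edges_iff_exists _).2 ⟨i, hi, rfl⟩
  intro x hx y hy hxy
  obtain ⟨i, rfl, hi⟩ := Walk.mem_support_iff_exists_getVert.1 hx
  obtain ⟨j, rfl, hj⟩ := Walk.mem_support_iff_exists_getVert.1 hy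
  rcases lt_trichotomy i j with h | h | h
  · have := h2 i j h hj hxy
    subst this
    exact key i (by omega)
  · subst h; exact absurd hxy (G.loopless.irrefl _)
  · have := h2 j i h hi hxy.symm
    subst this
    rw [Sym2.eq_swap]
    exact key j (by omega)

lemma path_through {S : Set V} (hS : Conn G S) {u v : V}
    (hu : ∃ x ∈ S, G.Adj u x) (hv : ∃ x ∈ S, G.Adj v x) (huv : u ≠ v) (hnadj : ¬ G.Adj u v) :
    ∃ P : G.Walk u v, IsInducedPathW G P ∧ (∀ x ∈ P.support, x = u ∨ x = v ∨ x ∈ S) ∧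
      2 ≤ P.length := by
  obtain ⟨x, hx, hux⟩ := hu
  obtain ⟨y, hy, hvy⟩ := hv
  obtain ⟨w, hw⟩ := conn_insert (conn_insert hS hy hvy) (Or.inr hx) hux u (Or.inl rfl) v
    (Or.inr (Or.inl rfl))
  obtain ⟨P, h1, h2, h3⟩ := exists_shortest w hw
  refine ⟨P, induced_of h2 h3, ?_, ?_⟩
  · intro t ht
    simpa using h1 t ht
  · by_contra hlt
    have : P.length = 0 ∨ P.length = 1 := by omega
    rcases this with h | h
    · exact huv (Walk.eq_of_length_eq_zero h)
    · exact hnadj (Walk.adj_of_length_eq_one h)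

lemma theta_of_sets (hG : ThetaFree G) {u v : V} (huv : u ≠ v) (hnadj : ¬ G.Adj u v)
    {S₁ S₂ S₃ : Set V} (c₁ : Conn G S₁) (c₂ : Conn G S₂) (c₃ : Conn G S₃)
    (u₁ : ∃ x ∈ S₁, G.Adj u x) (u₂ : ∃ x ∈ S₂, G.Adj u x) (u₃ : ∃ x ∈ S₃, G.Adj u x)
    (v₁ : ∃ x ∈ S₁, G.Adj v x) (v₂ : ∃ x ∈ S₂, G.Adj v x) (v₃ : ∃ x ∈ S₃, G.Adj v x)
    (d₁₂ : ∀ x ∈ S₁, ∀ y ∈ S₂, x ≠ y ∧ ¬ G.Adj x y)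
    (d₁₃ : ∀ x ∈ S₁, ∀ y ∈ S₃, x ≠ y ∧ ¬ G.Adj x y)
    (d₂₃ : ∀ x ∈ S₂, ∀ y ∈ S₃, x ≠ y ∧ ¬ G.Adj x y) : False := by
  obtain ⟨P₁, i₁, s₁, l₁⟩ := path_through c₁ u₁ v₁ huv hnadj
  obtain ⟨P₂, i₂, s₂, l₂⟩ := path_through c₂ u₂ v₂ huv hnadj
  obtain ⟨P₃, i₃, s₃, l₃⟩ := path_through c₃ u₃ v₃ huv hnadj
  have aux : ∀ {S : Set V} {P : G.Walk u v}, (∀ x ∈ P.support, x = u ∨ x = v ∨ x ∈ S) →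
      ∀ x ∈ interiorSet G P, x ∈ S := by
    rintro S P h x ⟨hx, h1, h2⟩
    rcases h x hx with h | h | h
    · exact absurd h h1
    · exact absurd h h2
    · exact h
  refine hG ⟨u, v, P₁, P₂, P₃, huv, hnadj, i₁, i₂, i₃, l₁, l₂, l₃, ?_, ?_, ?_, ?_, ?_, ?_⟩
  · exact Set.disjoint_left.2 fun x hx hy => (d₁₂ x (aux s₁ x hx) x (aux s₂ x hy)).1 rfl
  · exact Set.disjoint_left.2 fun x hx hy => (d₁₃ x (aux s₁ x hx) x (aux s₃ x hy)).1 rfl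
  · exact Set.disjoint_left.2 fun x hx hy => (d₂₃ x (aux s₂ x hx) x (aux s₃ x hy)).1 rfl
  · exact fun x hx y hy => (d₁₂ x (aux s₁ x hx) y (aux s₂ y hy)).2
  · exact fun x hx y hy => (d₁₃ x (aux s₁ x hx) y (aux s₃ y hy)).2
  · exact fun x hx y hy => (d₂₃ x (aux s₂ x hx) y (aux s₃ y hy)).2

lemma pyramid_of_sets (hG : PyramidFree G) {b : V} {t : Fin 3 → V} {S : Fin 3 → Set V}
    (c : ∀ i, Conn G (S i)) (hb : ∀ i, ∃ x ∈ S i, G.Adj b x)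
    (ht : ∀ i, ∃ x ∈ S i, G.Adj (t i) x)
    (hbt : ∀ i, b ≠ t i ∧ ¬ G.Adj b (t i))
    (htt : ∀ i j, i ≠ j → G.Adj (t i) (t j))
    (hSS : ∀ i j, i ≠ j → ∀ x ∈ S i, ∀ y ∈ S j, x ≠ y ∧ ¬ G.Adj x y)
    (htS : ∀ i j, i ≠ j → ∀ y ∈ S j, t i ≠ y ∧ ¬ G.Adj (t i) y) : False := by
  choose P hP hs hl using fun i => path_through (c i) (hb i) (ht i) (hbt i).1 (hbt i).2
  refine hG ⟨b, t, P, ?_, htt, hP, ?_, ?_, ?_, ?_⟩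
  · intro i j hij
    by_contra h
    exact (htt i j h).ne hij
  · intro i; have := hl i; omega
  · intro i j _ h; have := hl i; omega
  · intro i j hij v hv hv'
    rcases hs i v hv with h | h | h
    · exact h
    · rcases hs j v hv' with h' | h' | h'
      · exact h'
      · exact absurd (h.symm.trans h') (htt i j hij).ne
      · exact absurd h.symm (htS i j hij v h').1
    · rcases hs j v hv' with h' | h' | h'
      · exact h'
      · exact absurd h'.symm (htS j i hij.symm v h).1
      · exact absurd rfl (hSS i j hij v h v h').1
  · intro i j hij u hu v hv hub hvb hadj
    rcases hs i u hu with h | h | h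
    · exact absurd h hub
    · rcases hs j v hv with h' | h' | h'
      · exact absurd h' hvb
      · exact ⟨h, h'⟩
      · exact absurd (h ▸ hadj) (htS i j hij v h').2
    · rcases hs j v hv with h' | h' | h'
      · exact absurd h' hvb
      · exact absurd (h' ▸ hadj).symm (htS j i hij.symm u h).2
      · exact absurd hadj (hSS i j hij u h v h').2

/-- first-hitting lemma -/
lemma first_hit {Y N : Set V} {u v : V} (w : G.Walk u v) :
    (∀ x ∈ w.support, x ∈ Y) → u ∉ N → v ∈ N →
    ∃ (D : Set V) (q : V), Conn G D ∧ u ∈ D ∧ D ⊆ Y ∧ (∀ x ∈ D, x ∉ N) ∧ q ∈ Y ∧ q ∈ N ∧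
      ∃ x ∈ D, G.Adj q x := by
  induction w with
  | nil => intro _ h1 h2; exact absurd h2 h1
  | @cons u u' v h w ih =>
    intro hY hu hv
    have hY' : ∀ x ∈ w.support, x ∈ Y := fun x hx => hY x (by simp [hx])
    have huY : u ∈ Y := hY u (by simp)
    by_cases hu' : u' ∈ N
    · refine ⟨{u}, u', conn_singleton u, rfl, ?_, ?_, hY' u' (by simp), hu', u, rfl, h.symm⟩
      · rintro x rfl; exact huY
      · rintro x rfl; exact hu
    · obtain ⟨D, q, hD, hm, hDY, hDN, hqY, hqN, x, hx, hqx⟩ := ih hY' hu' hv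
      refine ⟨insert u D, q, conn_insert hD hm h, Or.inl rfl, ?_, ?_, hqY, hqN, x, Or.inr hx, hqx⟩
      · rintro y (rfl | hy)
        · exact huY
        · exact hDY hy
      · rintro y (rfl | hy)
        · exact hu
        · exact hDN y hy

lemma conn_interval {u v : V} (P : G.Walk u v) (l r : ℕ) (hlr : l ≤ r) (hr : r ≤ P.length) :
    Conn G {x | ∃ k, l ≤ k ∧ k ≤ r ∧ x = P.getVert k} := by
  induction r, hlr using Nat.le_induction with
  | base =>
    have : {x | ∃ k, l ≤ k ∧ k ≤ l ∧ x = P.getVert k} = {P.getVert l} := by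
      ext x
      constructor
      · rintro ⟨k, h1, h2, rfl⟩
        have : k = l := by omega
        subst this; rfl
      · rintro rfl; exact ⟨l, le_rfl, le_rfl, rfl⟩
    rw [this]; exact conn_singleton _
  | succ r hlr ih =>
    have : {x | ∃ k, l ≤ k ∧ k ≤ r + 1 ∧ x = P.getVert k} =
        insert (P.getVert (r+1)) {x | ∃ k, l ≤ k ∧ k ≤ r ∧ x = P.getVert k} := by
      ext x
      constructor
      · rintro ⟨k, h1, h2, rfl⟩
        rcases Nat.lt_or_ge r k with h | h
        · have : k = r + 1 := by omega
          subst this; exact Or.inl rfl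
        · exact Or.inr ⟨k, h1, h, rfl⟩
      · rintro (rfl | ⟨k, h1, h2, rfl⟩)
        · exact ⟨r+1, by omega, le_rfl, rfl⟩
        · exact ⟨k, h1, by omega, rfl⟩
    rw [this]
    exact conn_insert (ih (by omega)) ⟨r, hlr, le_rfl, rfl⟩ (P.adj_getVert_succ (by omega)).symm

/-- core lemma -/
lemma core (hT : ThetaFree G) (hP : PyramidFree G) {b a₁ a₂ a₃ d₁ d₂ d₃ : V} {C : Set V}
    (hC : Conn G C)
    (hb₁ : G.Adj b a₁) (hb₂ : G.Adj b a₂) (hb₃ : G.Adj b a₃)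
    (h₁₂ : a₁ ≠ a₂ ∧ ¬ G.Adj a₁ a₂) (h₁₃ : a₁ ≠ a₃ ∧ ¬ G.Adj a₁ a₃)
    (h₂₃ : a₂ ≠ a₃ ∧ ¬ G.Adj a₂ a₃)
    (e₁ : G.Adj a₁ d₁) (e₂ : G.Adj a₂ d₂) (e₃ : G.Adj a₃ d₃)
    (n₁₂ : ¬ G.Adj a₁ d₂) (n₁₃ : ¬ G.Adj a₁ d₃) (n₂₁ : ¬ G.Adj a₂ d₁) (n₂₃ : ¬ G.Adj a₂ d₃)
    (n₃₁ : ¬ G.Adj a₃ d₁) (n₃₂ : ¬ G.Adj a₃ d₂)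
    (f₁ : ∃ c ∈ C, G.Adj d₁ c) (f₂ : ∃ c ∈ C, G.Adj d₂ c) (f₃ : ∃ c ∈ C, G.Adj d₃ c)
    (g₁ : ¬ G.Adj b d₁) (g₂ : ¬ G.Adj b d₂) (g₃ : ¬ G.Adj b d₃)
    (cb : ∀ c ∈ C, c ≠ b ∧ ¬ G.Adj b c)
    (ca₁ : ∀ c ∈ C, ¬ G.Adj a₁ c) (ca₂ : ∀ c ∈ C, ¬ G.Adj a₂ c)
    (ca₃ : ∀ c ∈ C, ¬ G.Adj a₃ c)
    (da : d₁ ≠ b ∧ d₂ ≠ b ∧ d₃ ≠ b) : False := by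
  classical
  obtain ⟨c₁, hc₁, fc₁⟩ := f₁
  obtain ⟨c₂, hc₂, fc₂⟩ := f₂
  obtain ⟨c₃, hc₃, fc₃⟩ := f₃
  have hW : Conn G (insert a₁ (insert a₂ (insert d₁ (insert d₂ C)))) := by
    have h := conn_insert (conn_insert hC hc₂ fc₂) (Or.inr hc₁) fc₁
    have h := conn_insert h (Or.inr (Or.inl rfl)) e₂
    exact conn_insert h (Or.inr (Or.inl rfl)) e₁
  obtain ⟨w, hw⟩ := hW a₁ (by simp) a₂ (by simp)
  obtain ⟨P, pS, pP, pI⟩ := exists_shortest w hw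
  set n := P.length with hn
  have pinj : ∀ i j, i ≤ n → j ≤ n → P.getVert i = P.getVert j → i = j := by
    intro i j hi hj h
    exact pP.getVert_injOn hi hj h
  have p0 : P.getVert 0 = a₁ := P.getVert_zero
  have pn : P.getVert n = a₂ := P.getVert_length
  have padj : ∀ i, i < n → G.Adj (P.getVert i) (P.getVert (i+1)) :=
    fun i hi => P.adj_getVert_succ hi
  have pmem : ∀ i, P.getVert i ∈ P.support := fun i => P.getVert_mem_support i
  have pfar : ∀ i j, i + 1 < j → j ≤ n →
      P.getVert i ≠ P.getVert j ∧ ¬ G.Adj (P.getVert i) (P.getVert j) := by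
    intro i j hij hj
    refine ⟨fun h => ?_, fun h => ?_⟩
    · have := pinj i j (by omega) hj h; omega
    · have := pI i j (by omega) hj h; omega
  have pcl : ∀ x ∈ P.support, x = a₁ ∨ x = a₂ ∨ x = d₁ ∨ x = d₂ ∨ x ∈ C := by
    intro x hx; simpa using pS x hx
  have hn0 : 0 < n := by
    rcases Nat.eq_zero_or_pos n with h | h
    · rw [h, p0] at pn; exact absurd pn h₁₂.1
    · exact h
  -- interior vertices of P are not adjacent to b
  have pint : ∀ i, 0 < i → i < n → b ≠ P.getVert i ∧ ¬ G.Adj b (P.getVert i) := by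
    intro i h0 hi
    have e1 : P.getVert i ≠ a₁ := by
      intro h; have := pinj i 0 (by omega) (by omega) (h.trans p0.symm); omega
    have e2 : P.getVert i ≠ a₂ := by
      intro h; have := pinj i n (by omega) (by omega) (h.trans pn.symm); omega
    rcases pcl _ (pmem i) with h | h | h | h | h
    · exact absurd h e1
    · exact absurd h e2
    · rw [h]; exact ⟨da.1.symm, g₁⟩
    · rw [h]; exact ⟨da.2.1.symm, g₂⟩
    · exact ⟨(cb _ h).1.symm, (cb _ h).2⟩
  -- vertices with a neighbour in P
  let N : Set V := {x | ∃ y ∈ P.support, G.Adj x y}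
  have psubN : ∀ x ∈ P.support, x ∈ N := by
    intro x hx
    obtain ⟨i, rfl, hi⟩ := Walk.mem_support_iff_exists_getVert.1 hx
    rcases Nat.lt_or_ge i n with h | h
    · exact ⟨_, pmem (i+1), padj i h⟩
    · refine ⟨_, pmem (i-1), ?_⟩
      have := padj (i-1) (by omega)
      rw [show i - 1 + 1 = i by omega] at this
      exact this.symm
  have ha₃ : a₃ ∉ N := by
    rintro ⟨y, hy, hadj⟩
    rcases pcl y hy with rfl | rfl | rfl | rfl | h
    · exact h₁₃.2 hadj.symm
    · exact h₂₃.2 hadj.symm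
    · exact n₃₁ hadj
    · exact n₃₂ hadj
    · exact ca₃ y h hadj
  have hd₁P : d₁ ∈ P.support := by
    have h := padj 0 hn0
    rw [p0] at h
    rcases pcl _ (pmem (0+1)) with h' | h' | h' | h' | h'
    · rw [h'] at h; exact absurd h (G.loopless.irrefl _)
    · rw [h'] at h; exact absurd h h₁₂.2
    · rw [← h']; exact pmem _
    · rw [h'] at h; exact absurd h n₁₂
    · exact absurd h (ca₁ _ h')
  have hY : Conn G (insert a₃ (insert d₃ C)) :=
    conn_insert (conn_insert hC hc₃ fc₃) (Or.inl rfl) e₃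
  obtain ⟨w', hw'⟩ := hY a₃ (by simp) c₁ (by simp [hc₁])
  obtain ⟨D, q, hD, haD, hDY, hDN, hqY, hqN, hqD⟩ :=
    first_hit (N := N) w' hw' ha₃ ⟨d₁, hd₁P, fc₁.symm⟩
  have hqP : q ∉ P.support := by
    intro h
    obtain ⟨x, hx, hqx⟩ := hqD
    exact hDN x hx ⟨q, h, hqx.symm⟩
  have hqDn : q ∉ D := fun h => hDN q h hqN
  have hDP : ∀ i, ∀ y ∈ D, P.getVert i ≠ y ∧ ¬ G.Adj (P.getVert i) y := by
    intro i y hy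
    refine ⟨?_, fun h => hDN y hy ⟨_, pmem i, h.symm⟩⟩
    rintro rfl
    exact hDN _ hy (psubN _ (pmem i))
  have hq : q = d₃ ∨ q ∈ C := by
    rcases hqY with rfl | h | h
    · exact absurd hqN ha₃
    · exact Or.inl h
    · exact Or.inr h
  have hqb : b ≠ q ∧ ¬ G.Adj b q := by
    rcases hq with h | h
    · rw [h]; exact ⟨da.2.2.symm, g₃⟩
    · exact ⟨(cb _ h).1.symm, (cb _ h).2⟩
  have hqa₁ : ¬ G.Adj q a₁ := by
    intro h'
    rcases hq with h | h
    · rw [h] at h'; exact n₁₃ h'.symm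
    · exact ca₁ _ h h'.symm
  have hqa₂ : ¬ G.Adj q a₂ := by
    intro h'
    rcases hq with h | h
    · rw [h] at h'; exact n₂₃ h'.symm
    · exact ca₂ _ h h'.symm
  -- first and last neighbour indices
  let F : Finset ℕ := (Finset.range (n+1)).filter fun i => G.Adj q (P.getVert i)
  have hF : F.Nonempty := by
    obtain ⟨y, hy, hqy⟩ := hqN
    obtain ⟨i, rfl, hi⟩ := Walk.mem_support_iff_exists_getVert.1 hy
    exact ⟨i, by simp only [F, Finset.mem_filter, Finset.mem_range]; exact ⟨by omega, hqy⟩⟩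
  obtain ⟨i, hiF, himin⟩ := F.exists_min_image id hF
  obtain ⟨j, hjF, hjmax⟩ := F.exists_max_image id hF
  simp only [F, Finset.mem_filter, Finset.mem_range, id] at hiF hjF himin hjmax
  have hij : i ≤ j := himin j hjF
  have hi0 : 0 < i := by
    rcases Nat.eq_zero_or_pos i with h | h
    · have := hiF.2; rw [h, p0] at this; exact absurd this hqa₁
    · exact h
  have hjn : j < n := by
    rcases Nat.lt_or_ge j n with h | h
    · exact h
    · have h2 := hjF.2; rw [show j = n by omega, pn] at h2; exact absurd h2 hqa₂
  have hqlt : ∀ k, k ≤ n → (k < i ∨ j < k) → q ≠ P.getVert k ∧ ¬ G.Adj q (P.getVert k) := by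
    intro k hk h
    refine ⟨fun h' => hqP (h' ▸ pmem k), fun h' => ?_⟩
    have h1 := himin k ⟨by omega, h'⟩
    have h2 := hjmax k ⟨by omega, h'⟩
    omega
  have ba₁ : ∀ r, ∃ x ∈ {x | ∃ k, 0 ≤ k ∧ k ≤ r ∧ x = P.getVert k}, G.Adj b x :=
    fun r => ⟨a₁, ⟨0, le_rfl, Nat.zero_le _, p0.symm⟩, hb₁⟩
  have ba₂ : ∀ l, l ≤ n → ∃ x ∈ {x | ∃ k, l ≤ k ∧ k ≤ n ∧ x = P.getVert k}, G.Adj b x :=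
    fun l hl => ⟨a₂, ⟨n, hl, le_rfl, pn.symm⟩, hb₂⟩
  have ba₃ : ∃ x ∈ D, G.Adj b x := ⟨a₃, haD, hb₃⟩
  have dfar : ∀ r l, r + 1 < l → ∀ x ∈ {x | ∃ k, 0 ≤ k ∧ k ≤ r ∧ x = P.getVert k},
      ∀ y ∈ {x | ∃ k, l ≤ k ∧ k ≤ n ∧ x = P.getVert k}, x ≠ y ∧ ¬ G.Adj x y := by
    rintro r l hrl x ⟨k, -, hk, rfl⟩ y ⟨m, hm, hm', rfl⟩
    exact pfar k m (by omega) hm'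
  have dD : ∀ l r, ∀ x ∈ {x | ∃ k, l ≤ k ∧ k ≤ r ∧ x = P.getVert k},
      ∀ y ∈ D, x ≠ y ∧ ¬ G.Adj x y := by
    rintro l r x ⟨k, -, -, rfl⟩ y hy
    exact hDP k y hy
  have hprev : ∀ k, 0 < k → k ≤ n → G.Adj (P.getVert k) (P.getVert (k-1)) := by
    intro k h0 hk
    have := padj (k-1) (by omega)
    rw [show k - 1 + 1 = k by omega] at this
    exact this.symm
  rcases (show i = j ∨ j = i + 1 ∨ i + 1 < j by omega) with h | h | h
  · subst h
    refine theta_of_sets hT (pint i hi0 hjn).1 (pint i hi0 hjn).2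
      (conn_interval P 0 (i-1) (by omega) (by omega)) (conn_interval P (i+1) n (by omega) le_rfl)
      (S₃ := insert q D) ?_ (ba₁ _) (ba₂ _ (by omega)) ?_ ?_ ?_ ?_ ?_ ?_ ?_
    · obtain ⟨x, hx, hqx⟩ := hqD
      exact conn_insert hD hx hqx
    · obtain ⟨x, hx, hqx⟩ := ba₃
      exact ⟨x, Or.inr hx, hqx⟩
    · exact ⟨_, ⟨i-1, by omega, le_rfl, rfl⟩, hprev i hi0 (by omega)⟩
    · exact ⟨_, ⟨i+1, by omega, by omega, rfl⟩, padj i hjn⟩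
    · exact ⟨q, Or.inl rfl, hiF.2.symm⟩
    · exact dfar _ _ (by omega)
    · rintro x ⟨k, h1, h2, rfl⟩ y (rfl | hy)
      · have := hqlt k (by omega) (by omega)
        exact ⟨this.1.symm, fun h => this.2 h.symm⟩
      · exact hDP k y hy
    · rintro x ⟨k, h1, h2, rfl⟩ y (rfl | hy)
      · have := hqlt k (by omega) (by omega)
        exact ⟨this.1.symm, fun h => this.2 h.symm⟩
      · exact hDP k y hy
  · subst h
    have T1 := hiF.2
    have T2 := hjF.2
    have T3 := padj i (by omega)
    have A12 := dfar (i-1) (i+2) (by omega)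
    have A13 := dD 0 (i-1)
    have A23 := dD (i+2) n
    have B13 := hDP i
    have B23 := hDP (i+1)
    refine pyramid_of_sets hP (b := b) (t := ![P.getVert i, P.getVert (i+1), q])
      (S := ![{x | ∃ k, 0 ≤ k ∧ k ≤ i-1 ∧ x = P.getVert k},
        {x | ∃ k, i+2 ≤ k ∧ k ≤ n ∧ x = P.getVert k}, D]) ?_ ?_ ?_ ?_ ?_ ?_ ?_
    · intro s
      fin_cases s
      · exact conn_interval P 0 (i-1) (by omega) (by omega)
      · exact conn_interval P (i+2) n (by omega) le_rfl
      · exact hD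
    · intro s
      fin_cases s
      · exact ba₁ _
      · exact ba₂ _ (by omega)
      · exact ba₃
    · intro s
      fin_cases s
      · exact ⟨_, ⟨i-1, by omega, le_rfl, rfl⟩, hprev i hi0 (by omega)⟩
      · exact ⟨_, ⟨i+2, by omega, by omega, rfl⟩, padj (i+1) hjn⟩
      · exact hqD
    · intro s
      fin_cases s
      · exact pint i hi0 (by omega)
      · exact pint (i+1) (by omega) hjn
      · exact hqb
    · intro s t hst
      fin_cases s <;> fin_cases t <;> first | exact absurd rfl hst | skip
      · exact T3
      · exact T1.symm
      · exact T3.symm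
      · exact T2.symm
      · exact T1
      · exact T2
    · have sw : ∀ {A B : Set V}, (∀ x ∈ A, ∀ y ∈ B, x ≠ y ∧ ¬ G.Adj x y) →
          ∀ x ∈ B, ∀ y ∈ A, x ≠ y ∧ ¬ G.Adj x y :=
        fun h x hx y hy => ⟨(h y hy x hx).1.symm, fun h' => (h y hy x hx).2 h'.symm⟩
      intro s t hst
      fin_cases s <;> fin_cases t <;> first | exact absurd rfl hst | skip
      · exact A12
      · exact A13
      · exact sw A12
      · exact A23
      · exact sw A13
      · exact sw A23
    · intro s t hst
      fin_cases s <;> fin_cases t <;> first | exact absurd rfl hst | skip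
      · rintro y ⟨k, h1, h2, rfl⟩; exact pfar i k (by omega) h2
      · exact B13
      · rintro y ⟨k, h1, h2, rfl⟩
        have := pfar k (i+1) (by omega) (by omega)
        exact ⟨this.1.symm, fun h => this.2 h.symm⟩
      · exact B23
      · rintro y ⟨k, h1, h2, rfl⟩; exact hqlt k (by omega) (by omega)
      · rintro y ⟨k, h1, h2, rfl⟩; exact hqlt k (by omega) (by omega)
  · refine theta_of_sets hT hqb.1 hqb.2
      (conn_interval P 0 i (by omega) (by omega)) (conn_interval P j n (by omega) le_rfl)
      hD (ba₁ _) (ba₂ _ (by omega)) ba₃ ?_ ?_ hqD ?_ (dD _ _) (dD _ _)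
    · exact ⟨_, ⟨i, by omega, le_rfl, rfl⟩, hiF.2⟩
    · exact ⟨_, ⟨j, le_rfl, by omega, rfl⟩, hjF.2⟩
    · exact dfar _ _ h

lemma ramsey (H : SimpleGraph V) (w : ℕ) (s : ℕ) : ∀ T : Finset V,
    (∀ K : Finset V, K ⊆ T → H.IsClique (K : Set V) → K.card ≤ w) →
    (∀ I : Finset V, I ⊆ T → IsIndep H (I : Set V) → I.card ≤ s) →
    T.card < (w + 1) ^ s := by
  classical
  induction s with
  | zero =>
    intro T _ hI
    have : T = ∅ := by
      by_contra h
      obtain ⟨x, hx⟩ := Finset.nonempty_iff_ne_empty.2 h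
      have := hI {x} (by simpa using hx) (by
        intro a ha b hb hab
        simp at ha hb
        exact absurd (ha.trans hb.symm) hab)
      simp at this
    simp [this]
  | succ s ih =>
    intro T hK hI
    let Q : Finset (Finset V) := T.powerset.filter fun K : Finset V => H.IsClique (K : Set V)
    have hQ : Q.Nonempty := ⟨∅, by simp [Q]⟩
    obtain ⟨K, hKQ, hmax⟩ := Q.exists_max_image Finset.card hQ
    simp only [Q, Finset.mem_filter, Finset.mem_powerset] at hKQ hmax
    have hcov : T ⊆ K.biUnion fun v => insert v (T.filter fun x => x ≠ v ∧ ¬ H.Adj v x) := by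
      intro x hx
      rw [Finset.mem_biUnion]
      by_contra hcon
      push Not at hcon
      have hxK : x ∉ K := fun h => hcon x h (by simp)
      have hadj : ∀ v ∈ K, H.Adj x v := by
        intro v hv
        have := hcon v hv
        simp only [Finset.mem_insert, Finset.mem_filter, not_or, not_and, not_not] at this
        exact (this.2 hx this.1).symm
      have := hmax (insert x K) ⟨Finset.insert_subset hx hKQ.1, by
        rw [Finset.coe_insert, SimpleGraph.isClique_insert]
        exact ⟨hKQ.2, fun b hb _ => hadj b hb⟩⟩
      rw [Finset.card_insert_of_notMem hxK] at this
      omega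
    have hsm : ∀ v ∈ K, (insert v (T.filter fun x => x ≠ v ∧ ¬ H.Adj v x)).card ≤ (w+1)^s := by
      intro v hv
      refine (Finset.card_insert_le _ _).trans ?_
      apply ih
      · exact fun L hL => hK L (hL.trans (Finset.filter_subset _ _))
      · intro I hIs hind
        have hvI : v ∉ I := fun h => by
          have := hIs h
          simp at this
        have := hI (insert v I)
          (Finset.insert_subset (hKQ.1 hv) (hIs.trans (Finset.filter_subset _ _))) (by
            intro a ha c hc hac
            simp only [Finset.coe_insert, Set.mem_insert_iff, Finset.mem_coe] at ha hc
            rcases ha with rfl | ha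
            · rcases hc with rfl | hc
              · exact absurd rfl hac
              · exact (Finset.mem_filter.1 (hIs hc)).2.2
            · rcases hc with rfl | hc
              · exact fun h => (Finset.mem_filter.1 (hIs ha)).2.2 h.symm
              · exact hind ha hc hac)
        rw [Finset.card_insert_of_notMem hvI] at this
        omega
    have h1 : T.card ≤ K.card * (w+1)^s :=
      (Finset.card_le_card hcov).trans (Finset.card_biUnion_le_card_mul _ _ _ hsm)
    have h2 := hK K hKQ.1 hKQ.2
    have h3 : 0 < (w+1)^s := by positivity
    calc T.card ≤ K.card * (w+1)^s := h1
      _ ≤ w * (w+1)^s := Nat.mul_le_mul_right _ h2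
      _ < (w+1)^(s+1) := by rw [pow_succ]; nlinarith

lemma indep_bound (hT : ThetaFree G) (hP : PyramidFree G) {X : Set V} {b : V}
    (hX : Cooperative G Set.univ X) (hb : b ∈ nbhdS G X) (S : Finset V)
    (hS : (S : Set V) ⊆ G.neighborSet b ∩ X) (hI : IsIndep G (S : Set V)) : S.card ≤ 15 := by
  classical
  obtain ⟨-, -, hX1, hX2, hX3⟩ := hX
  have hbX : b ∉ X := hb.1
  have hSb : ∀ a ∈ S, G.Adj b a := fun a ha => (hS ha).1
  have hSX : ∀ a ∈ S, a ∈ X := fun a ha => (hS ha).2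
  have hS1 : ∀ a ∈ S, a ∈ delta1 G Set.univ X :=
    fun a ha => ⟨hSX a ha, b, ⟨trivial, hbX⟩, (hSb a ha).symm⟩
  have hin : ∀ x ∈ X \ delta1 G Set.univ X, ¬ G.Adj b x :=
    fun x hx h => hx.2 ⟨hx.1, b, ⟨trivial, hbX⟩, h.symm⟩
  have hneb : ∀ x ∈ X, x ≠ b := fun x hx h => hbX (h ▸ hx)
  have hex : ∀ a, ∃ d, a ∈ S → d ∈ X \ delta1 G Set.univ X ∧ G.Adj a d := by
    intro a
    by_cases ha : a ∈ S
    · obtain ⟨d, h1, h2⟩ := hX1 a (hS1 a ha)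
      exact ⟨d, fun _ => ⟨h1, h2⟩⟩
    · exact ⟨a, fun h => absurd h ha⟩
  choose d hd using hex
  have hd2 : ∀ a ∈ S, d a ∈ delta2 G Set.univ X := fun a ha =>
    ⟨(hd a ha).1, a, ⟨trivial, fun h => h.2 (hS1 a ha)⟩, (hd a ha).2.symm⟩
  -- no three
  have no3 : ∀ x ∈ S, ∀ y ∈ S, ∀ z ∈ S, y ≠ x → z ≠ x → y ≠ z →
      G.Adj (d x) y → G.Adj (d x) z → False := by
    intro x hx y hy z hz hyx hzx hyz h1 h2
    have hs : ∀ p ∈ S, ∀ r ∈ S, p ≠ r →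
        ∀ u ∈ ({p} : Set V), ∀ v ∈ ({r} : Set V), u ≠ v ∧ ¬ G.Adj u v := by
      rintro p hp r hr hpr u rfl v rfl
      exact ⟨hpr, hI hp hr hpr⟩
    exact theta_of_sets hT (hneb _ (hd x hx).1.1).symm (hin _ (hd x hx).1)
      (conn_singleton x) (conn_singleton y) (conn_singleton z)
      ⟨x, rfl, hSb x hx⟩ ⟨y, rfl, hSb y hy⟩ ⟨z, rfl, hSb z hz⟩
      ⟨x, rfl, (hd x hx).2.symm⟩ ⟨y, rfl, h1⟩ ⟨z, rfl, h2⟩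
      (hs x hx y hy hyx.symm) (hs x hx z hz hzx.symm) (hs y hy z hz hyz)
  have := ramsey (SimpleGraph.fromRel fun a a' => G.Adj (d a) a') 3 2 S ?_ ?_
  · norm_num at this; omega
  · intro K hKS hK
    by_contra hlt
    obtain ⟨x, hx⟩ : K.Nonempty := Finset.card_pos.1 (by omega)
    have hc : 2 < (K.erase x).card := by rw [Finset.card_erase_of_mem hx]; omega
    obtain ⟨y, z, t, hy, hz, ht, hyz, hyt, hzt⟩ := Finset.two_lt_card_iff.1 hc
    rw [Finset.mem_erase] at hy hz ht
    have R : ∀ u ∈ K, ∀ v ∈ K, u ≠ v → G.Adj (d u) v ∨ G.Adj (d v) u := by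
      intro u hu v hv huv
      exact ((SimpleGraph.fromRel_adj _ _ _).1 (hK hu hv huv)).2
    have M : ∀ u ∈ K, ∀ v ∈ K, ∀ r ∈ K, v ≠ u → r ≠ u → v ≠ r →
      G.Adj (d u) v → G.Adj (d u) r → False :=
      fun u hu v hv r hr => no3 u (hKS hu) v (hKS hv) r (hKS hr)
    -- two of y z t point to x
    have fin : ∀ u ∈ K, ∀ v ∈ K, u ≠ x → v ≠ x → u ≠ v → G.Adj (d u) x → G.Adj (d v) x →
        False := by
      intro u hu v hv hux hvx huv h1 h2
      rcases R u hu v hv huv with h | h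
      · exact M u hu x hx v hv hux.symm huv.symm hvx.symm h1 h
      · exact M v hv x hx u hu hvx.symm huv hux.symm h2 h
    rcases R x hx y hy.2 hy.1.symm with h1 | h1 <;> rcases R x hx z hz.2 hz.1.symm with h2 | h2 <;>
      rcases R x hx t ht.2 ht.1.symm with h3 | h3
    · exact M x hx y hy.2 z hz.2 hy.1 hz.1 hyz h1 h2
    · exact M x hx y hy.2 z hz.2 hy.1 hz.1 hyz h1 h2
    · exact M x hx y hy.2 t ht.2 hy.1 ht.1 hyt h1 h3
    · exact fin z hz.2 t ht.2 hz.1 ht.1 hzt h2 h3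
    · exact M x hx z hz.2 t ht.2 hz.1 ht.1 hzt h2 h3
    · exact fin y hy.2 t ht.2 hy.1 ht.1 hyt h1 h3
    · exact fin y hy.2 z hz.2 hy.1 hz.1 hyz h1 h2
    · exact fin y hy.2 z hz.2 hy.1 hz.1 hyz h1 h2
  · intro I hIS hII
    by_contra hlt
    obtain ⟨x, y, z, hx, hy, hz, hxy, hxz, hyz⟩ := Finset.two_lt_card_iff.1 (not_le.1 hlt)
    have R : ∀ u ∈ I, ∀ v ∈ I, u ≠ v → ¬ G.Adj u (d v) := by
      intro u hu v hv huv h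
      exact hII hu hv huv ((SimpleGraph.fromRel_adj _ _ _).2 ⟨huv, Or.inr h.symm⟩)
    have ix := hIS hx
    have iy := hIS hy
    have iz := hIS hz
    have hCin : ∀ c ∈ X \ (delta1 G Set.univ X ∪ delta2 G Set.univ X),
        c ∈ X \ delta1 G Set.univ X := fun c hc => ⟨hc.1, fun h => hc.2 (Or.inl h)⟩
    have hCS : ∀ a ∈ S, ∀ c ∈ X \ (delta1 G Set.univ X ∪ delta2 G Set.univ X),
        ¬ G.Adj a c := fun a ha c hc h =>
      hc.2 (Or.inr ⟨hCin c hc, a, ⟨trivial, fun h => h.2 (hS1 a ha)⟩, h.symm⟩)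
    exact core hT hP (conn_of_connSet hX3) (hSb x ix) (hSb y iy) (hSb z iz)
      ⟨hxy, hI ix iy hxy⟩ ⟨hxz, hI ix iz hxz⟩ ⟨hyz, hI iy iz hyz⟩
      (hd x ix).2 (hd y iy).2 (hd z iz).2
      (R x hx y hy hxy) (R x hx z hz hxz) (R y hy x hx hxy.symm) (R y hy z hz hyz)
      (R z hz x hx hxz.symm) (R z hz y hy hyz.symm)
      (hX2 _ (hd2 x ix)) (hX2 _ (hd2 y iy)) (hX2 _ (hd2 z iz))
      (hin _ (hd x ix).1) (hin _ (hd y iy).1) (hin _ (hd z iz).1)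
      (fun c hc => ⟨hneb c hc.1, hin c (hCin c hc)⟩)
      (hCS x ix) (hCS y iy) (hCS z iz)
      ⟨hneb _ (hd x ix).1.1, hneb _ (hd y iy).1.1, hneb _ (hd z iz).1.1⟩

end SNC

/-- In a (theta, pyramid)-free graph, every vertex in the neighborhood of a cooperative
set `X` has at most polynomially (in `ω(G)`) many neighbors in `X`. -/
theorem small_neighborhood_in_cooperative :
    ∃ p : Polynomial ℕ, ∀ (V : Type) [Fintype V] (G : SimpleGraph V) (X : Set V) (b : V),
      Paper.ThetaFree G → Paper.PyramidFree G →
      Paper.Cooperative G Set.univ X → b ∈ Paper.nbhdS G X →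
      (G.neighborSet b ∩ X).ncard ≤ p.eval G.cliqueNum := by
  classical
  refine ⟨(Polynomial.X + 1) ^ 15, ?_⟩
  intro V _ G X b hT hP hX hb
  have h := SNC.ramsey G G.cliqueNum 15 (G.neighborSet b ∩ X).toFinset
    (fun K _ hK => SimpleGraph.IsClique.card_le_cliqueNum (tc := hK))
    (fun I hI hInd => SNC.indep_bound hT hP hX hb I (by
      intro x hx
      exact Set.mem_toFinset.1 (hI hx)) hInd)
  rw [Set.ncard_eq_toFinset_card']
  simp only [Polynomial.eval_pow, Polynomial.eval_add, Polynomial.eval_X, Polynomial.eval_one]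
  exact h.le
end

section
/- There is a polynomial p such that every theta-free graph G on n ≥ 2 vertices with clique number ω admits a partition (S₁,…,S_k) of V(G) with: (1) k ≤ p(ω)·log n; (2) each S_i is an independent set; (3) for every i and every v ∈ S_i, the degree of v in the induced subgraph G \ (S₁ ∪ … ∪ S_{i-1}) is at most p(ω). -/
open SimpleGraph

namespace DP

variable {V : Type*}

/-- restriction of `G` to `X`, on the same vertex type -/
def R (G : SimpleGraph V) (X : Set V) : SimpleGraph V where
  Adj u v := G.Adj u v ∧ u ∈ X ∧ v ∈ X
  symm := ⟨fun _ _ h => ⟨h.1.symm, h.2.2, h.2.1⟩⟩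
  loopless := ⟨fun _ h => G.loopless.irrefl _ h.1⟩

lemma R_le (G : SimpleGraph V) (X : Set V) : R G X ≤ G := fun _ _ h => h.1

lemma R_support (G : SimpleGraph V) (X : Set V) {a b : V} (p : (R G X).Walk a b) (ha : a ∈ X) :
    ∀ u ∈ p.support, u ∈ X := by
  induction p with
  | nil => intro u hu; simp at hu; exact hu ▸ ha
  | cons h p ih =>
    intro u hu
    rw [Walk.support_cons, List.mem_cons] at hu
    rcases hu with rfl | hu
    · exact ha
    · exact ih h.2.2 u hu

lemma R_mem (G : SimpleGraph V) (X : Set V) {a b : V} (h : (R G X).Reachable a b) (ha : a ∈ X) :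
    b ∈ X := by
  obtain ⟨p⟩ := h
  exact R_support G X p ha b p.end_mem_support

lemma shortest_induced (H : SimpleGraph V) {a y : V} (Q : H.Walk a y)
    (hQ : Q.length = H.dist a y) :
    ∀ u ∈ Q.support, ∀ w ∈ Q.support, H.Adj u w → s(u, w) ∈ Q.edges := by
  classical
  induction Q with
  | nil =>
    intro u hu w hw h
    simp at hu hw
    subst hu; subst hw
    exact absurd h (H.loopless.irrefl _)
  | @cons a b y h Q ih =>
    have hQ' : Q.length = H.dist b y := by
      apply le_antisymm _ (H.dist_le Q)
      obtain ⟨q, hq⟩ := Q.reachable.exists_walk_length_eq_dist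
      have := H.dist_le (Walk.cons h q)
      simp at this hQ
      omega
    have key : ∀ w ∈ Q.support, H.Adj a w → w = b := by
      intro w hw haw
      have h1 := H.dist_le (Walk.cons haw (Q.dropUntil w hw))
      have h2 := congrArg Walk.length (Q.take_spec hw)
      rw [Walk.length_append] at h2
      simp at h1 hQ
      have h3 : (Q.takeUntil w hw).length = 0 := by omega
      exact (Walk.eq_of_length_eq_zero h3).symm
    intro u hu w hw huw
    rw [Walk.support_cons, List.mem_cons] at hu hw
    rw [Walk.edges_cons, List.mem_cons]
    rcases hu with rfl | hu
    · rcases hw with rfl | hw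
      · exact absurd huw (H.loopless.irrefl _)
      · left; rw [key w hw huw]
    · rcases hw with rfl | hw
      · left; rw [key u hu huw.symm, Sym2.eq_swap]
      · right; exact ih hQ' u hu w hw huw

lemma fin3_third (i j : Fin 3) (h : i ≠ j) :
    ∃ k, ∀ g : Fin 3 → ℕ, ∑ l, g l = g i + g j + g k := by
  fin_cases i <;> fin_cases j <;> simp at h
  · exact ⟨2, fun g => by simp [Fin.sum_univ_three]⟩
  · exact ⟨1, fun g => by simp [Fin.sum_univ_three]; ring⟩
  · exact ⟨2, fun g => by simp [Fin.sum_univ_three]; ring⟩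
  · exact ⟨0, fun g => by simp [Fin.sum_univ_three]; ring⟩
  · exact ⟨1, fun g => by simp [Fin.sum_univ_three]; ring⟩
  · exact ⟨0, fun g => by simp [Fin.sum_univ_three]; ring⟩

theorem theta_of_X (G : SimpleGraph V) (v : V) (z x : Fin 3 → V) (X : Set V)
    (hx : ∀ i, x i ∈ X) (hzx : ∀ i, G.Adj (z i) (x i)) (hvz : ∀ i, G.Adj v (z i))
    (hz : ∀ i j, i ≠ j → z i ≠ z j ∧ ¬ G.Adj (z i) (z j))
    (hXv : ∀ y ∈ X, y ≠ v ∧ ¬ G.Adj v y)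
    (hXz : ∀ i, ∀ y ∈ X, G.Adj (z i) y → y = x i)
    (conn : ∀ i, (R G X).Reachable (x 0) (x i))
    (htri : ∀ a ∈ X, ∀ b ∈ X, ∀ c ∈ X, G.Adj a b → G.Adj b c → G.Adj a c → False) :
    Paper.ContainsTheta G := by
  classical
  set H := R G X with hH
  let f : V → ℕ := fun c => ∑ i, H.dist c (x i)
  have hex : ∃ n, ∃ c, H.Reachable (x 0) c ∧ f c = n := ⟨_, x 0, Reachable.refl _, rfl⟩
  obtain ⟨c, hc0, hcf⟩ := Nat.find_spec hex
  have hmin : ∀ u, H.Reachable c u → f c ≤ f u := by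
    intro u hu
    rw [hcf]
    exact Nat.find_min' hex ⟨u, hc0.trans hu, rfl⟩
  have hcX : c ∈ X := R_mem G X hc0 (hx 0)
  have hcr : ∀ i, H.Reachable c (x i) := fun i => hc0.symm.trans (conn i)
  choose W hW using fun i => (hcr i).exists_walk_length_eq_dist
  have hWX : ∀ i, ∀ u ∈ (W i).support, u ∈ X := fun i => R_support G X (W i) hcX
  have hreach : ∀ i, ∀ u ∈ (W i).support, H.Reachable c u := fun i u hu =>
    ((W i).takeUntil u hu).reachable
  have hsplit : ∀ i, ∀ u ∈ (W i).support, H.dist c u + H.dist u (x i) = H.dist c (x i) := by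
    intro i u hu
    have h1 := H.dist_le ((W i).takeUntil u hu)
    have h2 := H.dist_le ((W i).dropUntil u hu)
    have h3 := congrArg Walk.length ((W i).take_spec hu)
    rw [Walk.length_append, hW] at h3
    have h4 := (hreach i u hu).dist_triangle_left (x i)
    omega
  have hdisj : ∀ i j, i ≠ j → ∀ u ∈ (W i).support, u ∈ (W j).support → u = c := by
    intro i j hij u hu hu'
    obtain ⟨k, hk⟩ := fin3_third i j hij
    have h1 := hsplit i u hu
    have h2 := hsplit j u hu'
    have h3 := (hreach i u hu).symm.dist_triangle_left (x k)
    have h4 := hmin u (hreach i u hu)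
    simp only [f, hk] at h4
    have h5 : H.dist u c = H.dist c u := H.dist_comm
    have h6 : H.dist c u = 0 := by omega
    exact ((hreach i u hu).dist_eq_zero_iff.1 h6).symm
  have hHadj : ∀ u ∈ X, ∀ w ∈ X, G.Adj u w → H.Adj u w := fun u hu w hw h => ⟨h, hu, hw⟩
  have half : ∀ i j, i ≠ j → ∀ u ∈ (W i).support, ∀ w ∈ (W j).support, G.Adj u w →
      H.dist c w ≤ 1 := by
    intro i j hij u hu w hw huw
    obtain ⟨k, hk⟩ := fin3_third i j hij
    have hadj := hHadj u (hWX i u hu) w (hWX j w hw) huw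
    have h1 := hsplit i u hu
    have h2 := hsplit j w hw
    have h3 := (hreach i u hu).symm.dist_triangle_left (x k)
    have h3' := hadj.reachable.dist_triangle_left (x j)
    have h4 := hmin u (hreach i u hu)
    simp only [f, hk] at h4
    have h5 : H.dist u c = H.dist c u := H.dist_comm
    have h6 : H.dist u w = 1 := H.dist_eq_one_iff_adj.2 hadj
    omega
  have hanti : ∀ i j, i ≠ j → ∀ u ∈ (W i).support, u ≠ c → ∀ w ∈ (W j).support, w ≠ c →
      ¬ G.Adj u w := by
    intro i j hij u hu huc w hw hwc huw
    have h1 := half i j hij u hu w hw huw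
    have h2 := half j i hij.symm w hw u hu huw.symm
    have h3 := (hreach i u hu).pos_dist_of_ne huc.symm
    have h4 := (hreach j w hw).pos_dist_of_ne hwc.symm
    have h5 : H.Adj c u := H.dist_eq_one_iff_adj.1 (by omega)
    have h6 : H.Adj c w := H.dist_eq_one_iff_adj.1 (by omega)
    exact htri c hcX u h5.2.2 w h6.2.2 h5.1 huw h6.1
  have hzX : ∀ i, z i ∉ X := fun i h => (hXv _ h).2 (hvz i)
  have hvX : v ∉ X := fun h => (hXv _ h).1 rfl
  let P : ∀ i, G.Walk c v := fun i =>
    ((W i).mapLe (R_le G X)).append (Walk.cons (hzx i).symm (Walk.cons (hvz i).symm Walk.nil))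
  have hPs : ∀ i, (P i).support = (W i).support ++ [z i, v] := by
    intro i
    simp only [P]
    rw [Walk.support_append, Walk.support_mapLe_eq_support]
    simp
  have hPe : ∀ i, (P i).edges = (W i).edges ++ [s(x i, z i), s(z i, v)] := by
    intro i
    simp only [P]
    rw [Walk.edges_append, Walk.edges_mapLe_eq_edges]
    simp
  have hPl : ∀ i, 2 ≤ (P i).length := by
    intro i
    simp only [P]
    rw [Walk.length_append]
    simp
  have hvz' : ∀ i, z i ≠ v := fun i h => G.loopless.irrefl v (by have := hvz i; rwa [h] at this)
  have hPind : ∀ i, Paper.IsInducedPathW G (P i) := by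
    intro i
    constructor
    · rw [Walk.isPath_def, hPs, List.nodup_append]
      refine ⟨((W i).isPath_of_length_eq_dist (hW i)).support_nodup, by simp [hvz' i], ?_⟩
      intro a ha b hb hab
      subst hab
      have := hWX i a ha
      simp at hb
      rcases hb with rfl | rfl
      · exact hzX i this
      · exact hvX this
    · intro u hu w hw huw
      have main : ∀ w ∈ (W i).support, G.Adj (z i) w → w = x i :=
        fun w hw h => hXz i w (hWX i w hw) h
      have main2 : ∀ w ∈ (W i).support, ¬ G.Adj v w := fun w hw => (hXv w (hWX i w hw)).2
      rw [hPs] at hu hw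
      rw [hPe]
      simp only [List.mem_append, List.mem_cons, List.not_mem_nil, or_false] at hu hw ⊢
      rcases hu with hu | rfl | rfl <;> rcases hw with hw | rfl | rfl
      · left
        exact shortest_induced H (W i) (hW i) u hu w hw
          (hHadj u (hWX i u hu) w (hWX i w hw) huw)
      · right; left; rw [main u hu huw.symm]
      · exact absurd huw.symm (main2 u hu)
      · right; left; rw [main w hw huw, Sym2.eq_swap]
      · exact absurd huw (G.loopless.irrefl _)
      · right; right; rfl
      · exact absurd huw (main2 w hw)
      · right; right; exact Sym2.eq_swap
      · exact absurd huw (G.loopless.irrefl _)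
  have hint : ∀ i, ∀ u ∈ Paper.interiorSet G (P i),
      (u ∈ (W i).support ∧ u ≠ c) ∨ u = z i := by
    rintro i u ⟨hu, huc, huv⟩
    rw [hPs] at hu
    simp only [List.mem_append, List.mem_cons, List.not_mem_nil, or_false] at hu
    tauto
  have hD : ∀ i j, i ≠ j →
      Disjoint (Paper.interiorSet G (P i)) (Paper.interiorSet G (P j)) := by
    intro i j hij
    rw [Set.disjoint_left]
    intro u hu hu'
    rcases hint i u hu with ⟨h1, h2⟩ | rfl <;> rcases hint j _ hu' with ⟨h3, h4⟩ | h3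
    · exact h2 (hdisj i j hij u h1 h3)
    · exact hzX j (h3 ▸ hWX i u h1)
    · exact hzX i (hWX j _ h3)
    · exact (hz i j hij).1 h3
  have hzW : ∀ i j, i ≠ j → ∀ u ∈ (W i).support, u ≠ c → ¬ G.Adj u (z j) := by
    intro i j hij u hu huc h
    have := hXz j u (hWX i u hu) h.symm
    subst this
    exact huc (hdisj i j hij _ hu (W j).end_mem_support)
  have hA : ∀ i j, i ≠ j →
      Paper.Anticomplete G (Paper.interiorSet G (P i)) (Paper.interiorSet G (P j)) := by
    intro i j hij u hu w hw huw
    rcases hint i u hu with ⟨h1, h2⟩ | rfl <;> rcases hint j _ hw with ⟨h3, h4⟩ | rfl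
    · exact hanti i j hij u h1 h2 w h3 h4 huw
    · exact hzW i j hij u h1 h2 huw
    · exact hzW j i hij.symm w h3 h4 huw.symm
    · exact (hz i j hij).2 huw
  exact ⟨c, v, P 0, P 1, P 2, (hXv c hcX).1, fun h => (hXv c hcX).2 h.symm,
    hPind 0, hPind 1, hPind 2, hPl 0, hPl 1, hPl 2,
    hD 0 1 (by decide), hD 0 2 (by decide), hD 1 2 (by decide),
    hA 0 1 (by decide), hA 0 2 (by decide), hA 1 2 (by decide)⟩

/-- nonadjacent vertices have no stable triple of common neighbours -/
lemma no_common_triple (G : SimpleGraph V) (hG : Paper.ThetaFree G) (a b : V) (hab : a ≠ b)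
    (hn : ¬ G.Adj a b) (z : Fin 3 → V) (hz : ∀ i j, i ≠ j → z i ≠ z j ∧ ¬ G.Adj (z i) (z j))
    (ha : ∀ i, G.Adj a (z i)) (hb : ∀ i, G.Adj b (z i)) : False := by
  apply hG
  refine theta_of_X G a z (fun _ => b) {b} (by simp) (fun i => (hb i).symm) ha hz ?_ ?_ ?_ ?_
  · rintro y rfl; exact ⟨hab.symm, hn⟩
  · rintro i y rfl _; rfl
  · intro i; exact Reachable.refl _
  · rintro a rfl b rfl c rfl h; exact absurd h (G.loopless.irrefl _)

end DP

namespace DP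

variable {V : Type*}

def Bl (G : SimpleGraph V) (U : Set V) (v : V) : Set V :=
  {u | u = v ∨ G.Adj v u ∨ ∃ z ∈ U, G.Adj v z ∧ G.Adj z u}

lemma R_mono (G : SimpleGraph V) {X Y : Set V} (h : X ⊆ Y) : R G X ≤ R G Y :=
  fun _ _ k => ⟨k.1, h k.2.1, h k.2.2⟩

lemma finish (G : SimpleGraph V) (U : Set V)
    (htri : ∀ a ∈ U, ∀ b ∈ U, ∀ c ∈ U, G.Adj a b → G.Adj b c → G.Adj a c → False)
    (hC4 : ∀ a ∈ U, ∀ b ∈ U, ∀ c ∈ U, ∀ d ∈ U, a ≠ c → b ≠ d → G.Adj a b → G.Adj b c →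
      G.Adj c d → G.Adj d a → False)
    (v : V) (hv : v ∈ U) (C : Set V) (hCU : C ⊆ U) (hCB : ∀ y ∈ C, y ∉ Bl G U v)
    (z x : Fin 3 → V) (hzi : Function.Injective z) (hzU : ∀ i, z i ∈ U)
    (hvz : ∀ i, G.Adj v (z i)) (hxU : ∀ i, x i ∈ U) (hzx : ∀ i, G.Adj (z i) (x i))
    (hxv : ∀ i, x i ≠ v)
    (conn : ∀ i, (R G (C ∪ Set.range x)).Reachable (x 0) (x i)) :
    Paper.ContainsTheta G := by
  have hXU : ∀ y ∈ C ∪ Set.range x, y ∈ U := by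
    rintro y (hy | ⟨i, rfl⟩)
    · exact hCU hy
    · exact hxU i
  refine theta_of_X G v z x (C ∪ Set.range x) (fun i => Or.inr ⟨i, rfl⟩) hzx hvz ?_ ?_ ?_ conn ?_
  · intro i j hij
    exact ⟨fun h => hij (hzi h), fun h => htri v hv _ (hzU i) _ (hzU j) (hvz i) h (hvz j)⟩
  · rintro y (hy | ⟨i, rfl⟩)
    · have := hCB y hy
      simp only [Bl, Set.mem_setOf_eq, not_or] at this
      exact ⟨this.1, this.2.1⟩
    · exact ⟨hxv i, fun h => htri v hv _ (hzU i) _ (hxU i) (hvz i) (hzx i) h⟩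
  · rintro i y (hy | ⟨j, rfl⟩) h
    · exact absurd (Or.inr (Or.inr ⟨z i, hzU i, hvz i, h⟩)) (hCB y hy)
    · by_cases hij : i = j
      · rw [hij]
      · exact (hC4 v hv _ (hzU i) _ (hxU j) _ (hzU j) (hxv j).symm (fun h => hij (hzi h))
          (hvz i) h (hzx j).symm (hvz j).symm).elim
  · intro a ha b hb c hc
    exact htri a (hXU a ha) b (hXU b hb) c (hXU c hc)

lemma claim (G : SimpleGraph V) (U : Set V)
    (htri : ∀ a ∈ U, ∀ b ∈ U, ∀ c ∈ U, G.Adj a b → G.Adj b c → G.Adj a c → False)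
    (hC4 : ∀ a ∈ U, ∀ b ∈ U, ∀ c ∈ U, ∀ d ∈ U, a ≠ c → b ≠ d → G.Adj a b → G.Adj b c →
      G.Adj c d → G.Adj d a → False)
    (h3 : ∀ u ∈ U, ∀ a, ∃ b ∈ U, ∃ c ∈ U, b ≠ c ∧ b ≠ a ∧ c ≠ a ∧ G.Adj u b ∧ G.Adj u c)
    (v : V) (hv : v ∈ U) (C : Set V) (hCU : C ⊆ U) (hCB : ∀ y ∈ C, y ∉ Bl G U v)
    (hCc : ∀ y ∈ C, ∀ y' ∈ C, (R G C).Reachable y y')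
    (z₁ x₁ : V) (hz1 : z₁ ∈ U) (hvz : G.Adj v z₁) (hx1 : x₁ ∈ U) (hzx : G.Adj z₁ x₁)
    (hxv : x₁ ≠ v) (hx1C : C = ∅ ∨ ∃ y ∈ C, G.Adj x₁ y)
    (hz : ∀ z ∈ U, G.Adj v z → z ≠ z₁ →
      (∃ x ∈ U, G.Adj z x ∧ x ≠ v ∧ ∃ y ∈ C, G.Adj x y) ∨ x₁ ∈ Bl G U z) :
    Paper.ContainsTheta G := by
  have hx1v : ¬ G.Adj v x₁ := fun h => htri v hv z₁ hz1 x₁ hx1 hvz hzx h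
  have key : ∀ z ∈ U, G.Adj v z → z ≠ z₁ → ∃ x ∈ U, G.Adj z x ∧ x ≠ v ∧
      ((R G (C ∪ {x₁, x})).Reachable x₁ x) := by
    intro z hzU hvz' hzz
    rcases hz z hzU hvz' hzz with ⟨x, hxU, hzx', hxv', y, hy, hxy⟩ | h
    · refine ⟨x, hxU, hzx', hxv', ?_⟩
      rcases hx1C with rfl | ⟨y', hy', hxy'⟩
      · exact absurd hy (by simp)
      · have e1 : (R G (C ∪ {x₁, x})).Adj x₁ y' := ⟨hxy', by simp, Or.inl hy'⟩
        have e2 : (R G (C ∪ {x₁, x})).Adj x y := ⟨hxy, by simp, Or.inl hy⟩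
        exact e1.reachable.trans (((hCc y' hy' y hy).mono
          (R_mono G Set.subset_union_left)).trans e2.symm.reachable)
    · rcases h with h | h | ⟨q, hqU, hzq, hqx⟩
      · exact absurd (h ▸ hvz') hx1v
      · exact (hC4 v hv z hzU x₁ hx1 z₁ hz1 hxv.symm hzz hvz' h hzx.symm hvz.symm).elim
      · refine ⟨q, hqU, hzq, ?_, ?_⟩
        · rintro rfl; exact hx1v hqx
        · exact Adj.reachable ⟨hqx.symm, by simp, by simp⟩
  obtain ⟨z₂, hz2, z₃, hz3, h23, h21, h31, hv2, hv3⟩ := h3 v hv z₁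
  obtain ⟨x₂, hx2, hzx2, hxv2, r2⟩ := key z₂ hz2 hv2 h21
  obtain ⟨x₃, hx3, hzx3, hxv3, r3⟩ := key z₃ hz3 hv3 h31
  refine finish G U htri hC4 v hv C hCU hCB ![z₁, z₂, z₃] ![x₁, x₂, x₃] ?_ ?_ ?_ ?_ ?_ ?_ ?_
  · intro i j
    fin_cases i <;> fin_cases j <;> simp [h23, h21, h31, h23.symm, h21.symm, h31.symm]
  · intro i; fin_cases i <;> simpa
  · intro i; fin_cases i <;> simpa
  · intro i; fin_cases i <;> simpa
  · intro i; fin_cases i <;> simpa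
  · intro i; fin_cases i <;> simpa
  · intro i
    have s2 : C ∪ {x₁, x₂} ⊆ C ∪ Set.range ![x₁, x₂, x₃] := by
      apply Set.union_subset_union_right
      rintro y (rfl | rfl)
      · exact ⟨0, rfl⟩
      · exact ⟨1, rfl⟩
    have s3 : C ∪ {x₁, x₃} ⊆ C ∪ Set.range ![x₁, x₂, x₃] := by
      apply Set.union_subset_union_right
      rintro y (rfl | rfl)
      · exact ⟨0, rfl⟩
      · exact ⟨2, rfl⟩
    fin_cases i
    · exact Reachable.refl _
    · exact r2.mono (R_mono G s2)
    · exact r3.mono (R_mono G s3)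

lemma cross (H : SimpleGraph V) {a b : V} (p : H.Walk a b) (C : Set V) (ha : a ∉ C) (hb : b ∈ C) :
    ∃ x y, x ∉ C ∧ y ∈ C ∧ H.Adj x y := by
  induction p with
  | nil => exact absurd hb ha
  | @cons a c b h p ih =>
    by_cases hc : c ∈ C
    · exact ⟨a, c, ha, hc, h⟩
    · exact ih hc hb

theorem theta_of_girth5 [Finite V] (G : SimpleGraph V) (U : Set V) (hne : U.Nonempty)
    (htri : ∀ a ∈ U, ∀ b ∈ U, ∀ c ∈ U, G.Adj a b → G.Adj b c → G.Adj a c → False)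
    (hC4 : ∀ a ∈ U, ∀ b ∈ U, ∀ c ∈ U, ∀ d ∈ U, a ≠ c → b ≠ d → G.Adj a b → G.Adj b c →
      G.Adj c d → G.Adj d a → False)
    (h3 : ∀ u ∈ U, ∀ a, ∃ b ∈ U, ∃ c ∈ U, b ≠ c ∧ b ≠ a ∧ c ≠ a ∧ G.Adj u b ∧ G.Adj u c) :
    Paper.ContainsTheta G := by
  classical
  let Q : Set (V × V) := {q | q.1 ∈ U ∧ q.2 ∈ U ∧ q.2 ∉ Bl G U q.1 ∧ (R G U).Reachable q.1 q.2}
  let CC : V × V → Set V := fun q => {y | (R G (U \ Bl G U q.1)).Reachable q.2 y}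
  by_cases hQ : Q.Nonempty
  · obtain ⟨⟨v, c⟩, ⟨hv, hcU, hcB, hr⟩, hmax⟩ :=
      (Set.toFinite Q).exists_maximalFor (fun q => (CC q).ncard) Q hQ
    simp only at hv hcU hcB hr
    have hmax' : ∀ q ∈ Q, (CC q).ncard ≤ (CC (v, c)).ncard := by
      intro q hq
      by_contra hlt
      exact hlt (hmax hq (by simp only; omega))
    set C := CC (v, c) with hC
    have hCsub : ∀ y ∈ C, y ∈ U \ Bl G U v := fun y hy => R_mem G _ hy ⟨hcU, hcB⟩
    have hcC : c ∈ C := Reachable.refl _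
    have hvC : v ∉ C := fun h => (hCsub v h).2 (Or.inl rfl)
    have step : ∀ (X : Set V) (c : V) {y y' : V} (p : (R G X).Walk y y'),
        (R G X).Reachable c y →
        (R G {y | (R G X).Reachable c y}).Reachable y y' := by
      intro X c y y' p
      induction p with
      | nil => intro _; exact Reachable.refl _
      | @cons a b d h p ih =>
        intro hca
        have hcb := hca.trans h.reachable
        have e : (R G {y | (R G X).Reachable c y}).Adj a b := ⟨h.1, hca, hcb⟩
        exact e.reachable.trans (ih hcb)
    have hCc : ∀ y ∈ C, ∀ y' ∈ C, (R G C).Reachable y y' := by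
      intro y hy y' hy'
      obtain ⟨p⟩ := (Reachable.symm hy).trans hy'
      exact step _ c p hy
    obtain ⟨p⟩ := hr
    obtain ⟨x₁, y₁, hx1C, hy1, hadj⟩ := cross _ p C hvC hcC
    have hx1U : x₁ ∈ U := hadj.2.1
    have hx1B : x₁ ∈ Bl G U v := by
      by_contra h
      apply hx1C
      have : (R G (U \ Bl G U v)).Adj y₁ x₁ := ⟨hadj.1.symm, hCsub y₁ hy1, hx1U, h⟩
      exact Reachable.trans hy1 this.reachable
    have hy1B := (hCsub y₁ hy1).2
    have hxv : x₁ ≠ v := by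
      rintro rfl; exact hy1B (Or.inr (Or.inl hadj.1))
    have hxv' : ¬ G.Adj v x₁ := fun h => hy1B (Or.inr (Or.inr ⟨x₁, hx1U, h, hadj.1⟩))
    obtain ⟨z₁, hz1, hvz, hzx⟩ : ∃ z ∈ U, G.Adj v z ∧ G.Adj z x₁ := by
      rcases hx1B with h | h | h
      · exact absurd h hxv
      · exact absurd h hxv'
      · exact h
    refine claim G U htri hC4 h3 v hv C (fun y hy => (hCsub y hy).1) (fun y hy => (hCsub y hy).2)
      hCc z₁ x₁ hz1 hvz hx1U hzx hxv (Or.inr ⟨y₁, hy1, hadj.1⟩) ?_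
    intro z hzU hvz' hzz
    by_contra hcon
    push Not at hcon
    obtain ⟨hun, hxB⟩ := hcon
    have hCz : ∀ y ∈ C, y ∈ U \ Bl G U z := by
      intro y hy
      refine ⟨(hCsub y hy).1, ?_⟩
      have hyB := (hCsub y hy).2
      rintro (rfl | h | ⟨q, hq, hzq, hqy⟩)
      · exact hyB (Or.inr (Or.inl hvz'))
      · exact hyB (Or.inr (Or.inr ⟨z, hzU, hvz', h⟩))
      · by_cases hqv : q = v
        · subst hqv; exact hyB (Or.inr (Or.inl hqy))
        · exact hun q hq hzq hqv y hy hqy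
    have hq : (z, x₁) ∈ Q := by
      refine ⟨hzU, hx1U, hxB, ?_⟩
      have a1 : (R G U).Adj z v := ⟨hvz'.symm, hzU, hv⟩
      have a2 : (R G U).Adj v z₁ := ⟨hvz, hv, hz1⟩
      have a3 : (R G U).Adj z₁ x₁ := ⟨hzx, hz1, hx1U⟩
      exact a1.reachable.trans (a2.reachable.trans a3.reachable)
    have hlt : C.ncard < (CC (z, x₁)).ncard := by
      apply Set.ncard_lt_ncard _ (Set.toFinite _)
      refine ⟨?_, fun h => hx1C (h (Reachable.refl _))⟩
      intro y hy
      have e1 : (R G (U \ Bl G U z)).Adj x₁ y₁ := ⟨hadj.1, ⟨hx1U, hxB⟩, hCz y₁ hy1⟩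
      exact e1.reachable.trans ((hCc y₁ hy1 y hy).mono (R_mono G hCz))
    exact absurd (hmax' _ hq) (by omega)
  · obtain ⟨v, hv⟩ := hne
    obtain ⟨z₁, hz1, -, -, -, -, -, hvz, -⟩ := h3 v hv v
    obtain ⟨x₁, hx1, -, -, -, hxv, -, hzx, -⟩ := h3 z₁ hz1 v
    refine claim G U htri hC4 h3 v hv ∅ (by simp) (by simp) (by simp) z₁ x₁ hz1 hvz hx1 hzx hxv
      (Or.inl rfl) ?_
    intro z hzU hvz' hzz
    right
    by_contra hxB
    apply hQ
    refine ⟨(z, x₁), hzU, hx1, hxB, ?_⟩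
    have a1 : (R G U).Adj z v := ⟨hvz'.symm, hzU, hv⟩
    have a2 : (R G U).Adj v z₁ := ⟨hvz, hv, hz1⟩
    have a3 : (R G U).Adj z₁ x₁ := ⟨hzx, hz1, hx1⟩
    exact a1.reachable.trans (a2.reachable.trans a3.reachable)

end DP

namespace DP

open Finset

variable {V : Type*} [DecidableEq V] (G : SimpleGraph V) [DecidableRel G.Adj]

lemma ramsey3 (w : ℕ) : ∀ K : Finset V,
    (∀ a ∈ K, ∀ b ∈ K, ∀ c ∈ K, a ≠ b → a ≠ c → b ≠ c →
      ¬ G.Adj a b → ¬ G.Adj a c → ¬ G.Adj b c → False) →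
    (∀ T ⊆ K, G.IsClique (T : Set V) → #T ≤ w) → #K ≤ (w + 1) ^ 2 := by
  induction w with
  | zero =>
    intro K _ hK
    rcases K.eq_empty_or_nonempty with rfl | ⟨v, hv⟩
    · simp
    · have := hK {v} (by simpa using hv) (by simp)
      simp at this
  | succ w ih =>
    intro K hs hK
    rcases K.eq_empty_or_nonempty with rfl | ⟨v, hv⟩
    · simp
    · have h1 := ih (K.filter (G.Adj v)) (by
        intro a ha b hb c hc
        exact hs a (mem_filter.1 ha).1 b (mem_filter.1 hb).1 c (mem_filter.1 hc).1) (by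
        intro T hT hcl
        have hvT : v ∉ T := fun h => G.loopless.irrefl v (mem_filter.1 (hT h)).2
        have := hK (insert v T) (by
          intro x hx
          rcases mem_insert.1 hx with rfl | hx
          · exact hv
          · exact (mem_filter.1 (hT hx)).1) (by
          rw [coe_insert]
          exact hcl.insert (fun b hb _ => (mem_filter.1 (hT hb)).2))
        rw [card_insert_of_notMem hvT] at this
        omega)
      have h2 := hK ((K.filter (fun u => ¬ G.Adj v u)).erase v) (by
          intro x hx
          exact (mem_filter.1 (mem_erase.1 hx).2).1) (by
          intro a ha b hb hab
          have ha' := mem_erase.1 ha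
          have hb' := mem_erase.1 hb
          by_contra hn
          exact hs v hv a (mem_filter.1 ha'.2).1 b (mem_filter.1 hb'.2).1 ha'.1.symm hb'.1.symm
            hab (mem_filter.1 ha'.2).2 (mem_filter.1 hb'.2).2 hn)
      rw [card_erase_of_mem (by simp [hv])] at h2
      have h3 := card_filter_add_card_filter_not (s := K) (G.Adj v)
      have h4 : (w + 1 + 1) ^ 2 = (w + 1) ^ 2 + 2 * w + 3 := by ring
      omega

lemma turan (w : ℕ) : ∀ K : Finset V,
    (∀ T ⊆ K, G.IsClique (T : Set V) → #T ≤ w) →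
    #K ^ 2 ≤ w * ∑ a ∈ K, #(K.filter (fun b => ¬ G.Adj a b)) := by
  induction w with
  | zero =>
    intro K hK
    rcases K.eq_empty_or_nonempty with rfl | ⟨v, hv⟩
    · simp
    · have := hK {v} (by simpa using hv) (by simp)
      simp at this
  | succ w ih =>
    intro K hK
    rcases K.eq_empty_or_nonempty with rfl | hne
    · simp
    · obtain ⟨v, hv, hmax⟩ := exists_max_image K (fun v => #(K.filter (G.Adj v))) hne
      set A := K.filter (G.Adj v) with hA
      set B := K.filter (fun u => ¬ G.Adj v u) with hB
      have h1 := ih A (by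
        intro T hT hcl
        have hvT : v ∉ T := fun h => G.loopless.irrefl v (mem_filter.1 (hT h)).2
        have := hK (insert v T) (by
          intro x hx
          rcases mem_insert.1 hx with rfl | hx
          · exact hv
          · exact (mem_filter.1 (hT hx)).1) (by
          rw [coe_insert]
          exact hcl.insert (fun b hb _ => (mem_filter.1 (hT hb)).2))
        rw [card_insert_of_notMem hvT] at this
        omega)
      have h3 : #A + #B = #K := card_filter_add_card_filter_not (s := K) (fun u => G.Adj v u)
      have h4 : ∑ a ∈ A, #(K.filter (fun b => ¬ G.Adj a b)) +
          ∑ a ∈ B, #(K.filter (fun b => ¬ G.Adj a b)) =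
          ∑ a ∈ K, #(K.filter (fun b => ¬ G.Adj a b)) := sum_filter_add_sum_filter_not K _ _
      have h5 : ∑ a ∈ A, #(A.filter (fun b => ¬ G.Adj a b)) ≤
          ∑ a ∈ A, #(K.filter (fun b => ¬ G.Adj a b)) :=
        sum_le_sum fun a _ => card_le_card (filter_subset_filter _ (filter_subset _ _))
      have h6 : #B * #B ≤ ∑ a ∈ B, #(K.filter (fun b => ¬ G.Adj a b)) := by
        rw [← smul_eq_mul]
        apply card_nsmul_le_sum
        intro a ha
        have e1 := hmax a (mem_filter.1 ha).1
        have e2 := card_filter_add_card_filter_not (s := K) (G.Adj a)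
        omega
      rw [← h4, ← h3]
      generalize (∑ a ∈ A, #(A.filter (fun b => ¬ G.Adj a b))) = Y at *
      generalize (∑ a ∈ A, #(K.filter (fun b => ¬ G.Adj a b))) = Y' at *
      generalize (∑ a ∈ B, #(K.filter (fun b => ¬ G.Adj a b))) = Z at *
      generalize #A = δ at *
      generalize #B = q at *
      have h7 : 2 * q * δ ≤ w * (q * q) + Y := by
        rcases Nat.eq_zero_or_pos w with rfl | hw
        · have : δ = 0 := by
            have : δ ^ 2 = 0 := by omega
            simpa using this
          simp [this]
        · apply Nat.le_of_mul_le_mul_left _ hw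
          zify at *
          nlinarith [sq_nonneg ((w : ℤ) * q - δ)]
      nlinarith

lemma e2_bound (w t : ℕ) (hcl : ∀ T : Finset V, G.IsClique (T : Set V) → #T ≤ w)
    (hco : ∀ a b, a ≠ b → ¬ G.Adj a b → ∀ F : Finset V,
      #(F.filter (fun x => G.Adj a x ∧ G.Adj b x)) ≤ t)
    (F : Finset V) :
    (∑ x ∈ F, #(F.filter (G.Adj x))) ^ 2 ≤ w * (t + 1) * #F ^ 3 := by
  have h1 : (∑ x ∈ F, #(F.filter (G.Adj x))) ^ 2 ≤ #F * ∑ x ∈ F, #(F.filter (G.Adj x)) ^ 2 :=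
    sq_sum_le_card_mul_sum_sq
  have h2 : ∑ x ∈ F, #(F.filter (G.Adj x)) ^ 2 ≤
      ∑ x ∈ F, w * ∑ a ∈ F.filter (G.Adj x),
        #((F.filter (G.Adj x)).filter (fun b => ¬ G.Adj a b)) :=
    sum_le_sum fun x _ => turan G w _ (fun T _ h => hcl T h)
  rw [← mul_sum] at h2
  have h3 : ∑ x ∈ F, ∑ a ∈ F.filter (G.Adj x),
        #((F.filter (G.Adj x)).filter (fun b => ¬ G.Adj a b)) ≤ (t + 1) * #F ^ 2 := by
    have e1 : ∑ x ∈ F, ∑ a ∈ F.filter (G.Adj x),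
        #((F.filter (G.Adj x)).filter (fun b => ¬ G.Adj a b)) =
        ∑ a ∈ F, ∑ b ∈ F, if ¬ G.Adj a b then
          #(F.filter (fun x => G.Adj a x ∧ G.Adj b x)) else 0 := by
      simp only [card_filter, sum_filter]
      rw [sum_comm]
      apply sum_congr rfl
      intro a _
      have : ∀ x ∈ F, (if G.Adj x a then ∑ b ∈ F, if G.Adj x b then
          if ¬ G.Adj a b then 1 else 0 else 0 else 0) =
          ∑ b ∈ F, if ¬ G.Adj a b then (if G.Adj a x ∧ G.Adj b x then 1 else 0) else 0 := by
        intro x _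
        by_cases hxa : G.Adj x a
        · rw [if_pos hxa]
          apply sum_congr rfl
          intro b _
          simp only [hxa.symm, true_and, G.adj_comm x b]
          split_ifs <;> rfl
        · have : ¬ G.Adj a x := fun h => hxa h.symm
          simp [hxa, this]
      rw [sum_congr rfl this, sum_comm]
      apply sum_congr rfl
      intro b _
      split_ifs <;> simp
    rw [e1]
    have e2 : ∀ a ∈ F, ∑ b ∈ F, (if ¬ G.Adj a b then
          #(F.filter (fun x => G.Adj a x ∧ G.Adj b x)) else 0) ≤ (t + 1) * #F := by
      intro a ha
      calc _ ≤ ∑ b ∈ F, ((if a = b then #F else 0) + t) := by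
            apply sum_le_sum
            intro b _
            by_cases hab : a = b
            · subst hab
              have := card_filter_le F (fun x => G.Adj a x ∧ G.Adj a x)
              simp only [if_true]
              split_ifs <;> omega
            · by_cases h : G.Adj a b
              · simp [h]
              · simpa [h, hab] using hco a b hab h F
        _ = (t + 1) * #F := by
            rw [sum_add_distrib, sum_ite_eq, if_pos ha]
            simp; ring
    calc _ ≤ ∑ a ∈ F, (t + 1) * #F := sum_le_sum e2
      _ = _ := by simp; ring
  calc _ ≤ #F * (w * ((t + 1) * #F ^ 2)) := h1.trans
        (Nat.mul_le_mul_left _ (h2.trans (Nat.mul_le_mul_left _ h3)))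
    _ = _ := by ring

/-- every nonempty subset of `W` has a vertex with at most `P` neighbours inside -/
def HD (P : ℕ) (W : Finset V) : Prop :=
  ∀ S ⊆ W, S.Nonempty → ∃ v ∈ S, #(S.filter (G.Adj v)) ≤ P

lemma HD.mono {P : ℕ} {W W' : Finset V} (h : HD G P W) (hs : W' ⊆ W) : HD G P W' :=
  fun S hS => h S (hS.trans hs)

lemma exists_order (P : ℕ) (W : Finset V) (h : HD G P W) :
    ∃ o : V → ℕ, Set.InjOn o W ∧
      ∀ u ∈ W, #(W.filter (fun v => G.Adj u v ∧ o u < o v)) ≤ P := by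
  induction W using Finset.strongInduction with
  | H W ih =>
    rcases W.eq_empty_or_nonempty with rfl | hne
    · exact ⟨fun _ => 0, by simp, by simp⟩
    · obtain ⟨v, hv, hd⟩ := h W subset_rfl hne
      obtain ⟨o, ho, hf⟩ := ih _ (erase_ssubset hv) (h.mono G (erase_subset _ _))
      refine ⟨fun x => if x = v then 0 else o x + 1, ?_, ?_⟩
      · intro a ha b hb hab
        by_cases h1 : a = v <;> by_cases h2 : b = v <;> simp [h1, h2] at hab ⊢
        exact ho (by simpa [h1] using ha) (by simpa [h2] using hb) hab
      · intro u hu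
        by_cases huv : u = v
        · subst huv
          exact (card_le_card (monotone_filter_right _ (fun x _ hx => hx.1))).trans hd
        · refine (card_le_card ?_).trans (hf u (mem_erase.2 ⟨huv, hu⟩))
          intro x hx
          obtain ⟨hx1, hx2, hx3⟩ := mem_filter.1 hx
          by_cases hxv : x = v
          · simp [hxv] at hx3
          · simp [huv, hxv] at hx3
            simp [hxv, hx1, hx2, hx3]

lemma sum_deg_order (W : Finset V) (o : V → ℕ) (ho : Set.InjOn o W) :
    ∑ u ∈ W, #(W.filter (G.Adj u)) =
      2 * ∑ u ∈ W, #(W.filter (fun v => G.Adj u v ∧ o u < o v)) := by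
  have h1 : ∀ u ∈ W, #(W.filter (G.Adj u)) = #(W.filter (fun v => G.Adj u v ∧ o u < o v)) +
      #(W.filter (fun v => G.Adj u v ∧ o v < o u)) := by
    intro u hu
    rw [← card_union_of_disjoint]
    · congr 1
      ext v
      simp only [mem_filter, mem_union]
      constructor
      · rintro ⟨hv, ha⟩
        have : o u ≠ o v := fun h => G.ne_of_adj ha (ho hu hv h)
        rcases lt_or_gt_of_ne this with h | h
        · exact Or.inl ⟨hv, ha, h⟩
        · exact Or.inr ⟨hv, ha, h⟩
      · rintro (h | h) <;> exact ⟨h.1, h.2.1⟩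
    · rw [Finset.disjoint_left]
      intro v hv hv'
      have := (mem_filter.1 hv).2.2
      have := (mem_filter.1 hv').2.2
      omega
  rw [sum_congr rfl h1, sum_add_distrib, two_mul]
  congr 1
  simp only [card_filter]
  rw [sum_comm]
  apply sum_congr rfl
  intro u _
  apply sum_congr rfl
  intro v _
  simp only [G.adj_comm]

lemma sum_deg_le (P : ℕ) (W : Finset V) (h : HD G P W) :
    ∑ u ∈ W, #(W.filter (G.Adj u)) ≤ 2 * (P * #W) := by
  obtain ⟨o, ho, hf⟩ := exists_order G P W h
  rw [sum_deg_order G W o ho]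
  apply Nat.mul_le_mul_left
  calc _ ≤ ∑ u ∈ W, P := sum_le_sum hf
    _ = _ := by simp [mul_comm]

lemma exists_coloring (P : ℕ) (W : Finset V) (h : HD G P W) :
    ∃ c : V → ℕ, (∀ v ∈ W, c v < P + 1) ∧ ∀ u ∈ W, ∀ v ∈ W, G.Adj u v → c u ≠ c v := by
  induction W using Finset.strongInduction with
  | H W ih =>
    rcases W.eq_empty_or_nonempty with rfl | hne
    · exact ⟨fun _ => 0, by simp, by simp⟩
    · obtain ⟨v, hv, hd⟩ := h W subset_rfl hne
      obtain ⟨c, hc, hp⟩ := ih _ (erase_ssubset hv) (h.mono G (erase_subset _ _))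
      obtain ⟨k, hk, hk'⟩ : ∃ k ∈ range (P + 1), k ∉ (W.filter (G.Adj v)).image c := by
        apply exists_mem_notMem_of_card_lt_card
        rw [card_range]
        exact Nat.lt_succ_of_le (card_image_le.trans hd)
      have hk2 : ∀ u ∈ W, G.Adj v u → c u ≠ k := by
        rintro u hu ha rfl
        exact hk' (mem_image_of_mem _ (mem_filter.2 ⟨hu, ha⟩))
      refine ⟨fun x => if x = v then k else c x, ?_, ?_⟩
      · intro u hu
        by_cases huv : u = v
        · simpa [huv] using hk
        · simpa [huv] using hc u (mem_erase.2 ⟨huv, hu⟩)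
      · intro a ha b hb hab
        by_cases h1 : a = v <;> by_cases h2 : b = v
        · subst h1; subst h2; exact absurd hab (G.loopless.irrefl _)
        · subst h1; simpa [h2] using (hk2 b hb hab).symm
        · subst h2; simpa [h1] using hk2 a ha hab.symm
        · simpa [h1, h2] using hp a (mem_erase.2 ⟨h1, ha⟩) b (mem_erase.2 ⟨h2, hb⟩) hab

lemma exists_rank (P : ℕ) (s : ℕ) : ∀ W : Finset V, HD G P W → #W < 2 ^ s →
    ∃ r : V → ℕ, (∀ v ∈ W, r v < (P + 1) * s) ∧ (∀ u ∈ W, ∀ v ∈ W, G.Adj u v → r u ≠ r v) ∧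
      ∀ v ∈ W, #(W.filter (fun u => G.Adj v u ∧ r v ≤ r u)) ≤ 4 * P := by
  induction s with
  | zero =>
    intro W _ hW
    have : W = ∅ := by simpa using hW
    subst this
    exact ⟨fun _ => 0, by simp, by simp, by simp⟩
  | succ s ih =>
    intro W h hW
    set L := W.filter (fun v => #(W.filter (G.Adj v)) ≤ 4 * P) with hL
    set K := W.filter (fun v => ¬ #(W.filter (G.Adj v)) ≤ 4 * P) with hK
    have hsum := sum_deg_le G P W h
    have h1 : #K * (4 * P + 1) ≤ ∑ u ∈ W, #(W.filter (G.Adj u)) := by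
      calc _ ≤ ∑ u ∈ K, #(W.filter (G.Adj u)) := by
            rw [← smul_eq_mul]
            apply card_nsmul_le_sum
            intro u hu
            have := (mem_filter.1 hu).2
            omega
        _ ≤ _ := sum_le_sum_of_subset (filter_subset _ _)
    have h2 : 2 * #K ≤ #W := by
      by_contra hlt
      push Not at hlt
      have : #W * P ≤ 2 * #K * P := Nat.mul_le_mul_right _ hlt.le
      have h0 : 0 < #K := by omega
      nlinarith
    have hKW : K ⊆ W := filter_subset _ _
    have hLW : L ⊆ W := filter_subset _ _
    obtain ⟨r, hr, hp, hd⟩ := ih K (h.mono G hKW) (by rw [pow_succ] at hW; omega)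
    obtain ⟨c, hc, hcp⟩ := exists_coloring G P L (h.mono G hLW)
    have hcase : ∀ v ∈ W, v ∉ L → v ∈ K := by
      intro v hv hvL
      refine mem_filter.2 ⟨hv, fun h => hvL (mem_filter.2 ⟨hv, h⟩)⟩
    refine ⟨fun v => if v ∈ L then c v else (P + 1) + r v, ?_, ?_, ?_⟩
    · intro v hv
      rw [mul_add, mul_one]
      by_cases hvL : v ∈ L
      · have := hc v hvL
        simp only [hvL, if_true]; omega
      · have := hr v (hcase v hv hvL)
        simp only [hvL, if_false]; omega
    · intro u hu v hv huv
      by_cases huL : u ∈ L <;> by_cases hvL : v ∈ L <;> simp only [huL, hvL, if_true, if_false]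
      · exact hcp u huL v hvL huv
      · have := hc u huL; omega
      · have := hc v hvL; omega
      · have := hp u (hcase u hu huL) v (hcase v hv hvL) huv; omega
    · intro v hv
      by_cases hvL : v ∈ L
      · exact (card_le_card (monotone_filter_right _ (fun x _ hx => hx.1))).trans
          (mem_filter.1 hvL).2
      · refine (card_le_card ?_).trans (hd v (hcase v hv hvL))
        intro u hu
        obtain ⟨hu1, hu2, hu3⟩ := mem_filter.1 hu
        have huL : u ∉ L := by
          intro huL
          have := hc u huL
          simp only [huL, hvL, if_true, if_false] at hu3
          omega
        simp only [huL, hvL, if_false] at hu3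
        exact mem_filter.2 ⟨hcase u hu1 huL, hu2, by omega⟩

end DP

namespace DP

open Finset

variable {V : Type*} [Fintype V] [DecidableEq V] (G : SimpleGraph V) [DecidableRel G.Adj]

lemma cnt_eq (m : ℕ) [NeZero m] (T : Finset V) :
    (#(univ.filter (fun f : V → Fin m => ∀ x ∈ T, f x = 0)) : ℝ) =
      (m : ℝ) ^ Fintype.card V * (1 / (m : ℝ)) ^ #T := by
  have h1 : univ.filter (fun f : V → Fin m => ∀ x ∈ T, f x = 0) =
      Fintype.piFinset (fun x => if x ∈ T then ({0} : Finset (Fin m)) else univ) := by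
    ext f
    simp only [mem_filter, mem_univ, true_and, Fintype.mem_piFinset]
    apply forall_congr'
    intro x
    by_cases hx : x ∈ T <;> simp [hx]
  have h2 : #(univ.filter (fun f : V → Fin m => ∀ x ∈ T, f x = 0)) =
      m ^ #(univ.filter (fun x : V => x ∉ T)) := by
    rw [h1, Fintype.card_piFinset]
    have : ∀ x : V, #(if x ∈ T then ({0} : Finset (Fin m)) else univ) = if x ∈ T then 1 else m := by
      intro x; split_ifs <;> simp
    simp only [this]
    rw [prod_ite]
    simp
  have h3 : #T + #(univ.filter (fun x : V => x ∉ T)) = Fintype.card V := by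
    have := card_filter_add_card_filter_not (s := (univ : Finset V)) (fun x => x ∈ T)
    simpa using this
  have hm : (m : ℝ) ≠ 0 := by exact_mod_cast NeZero.ne m
  rw [h2, ← h3, pow_add]
  push_cast
  have : (m : ℝ) ^ #T * (1 / (m : ℝ)) ^ #T = 1 := by
    rw [← mul_pow, mul_one_div_cancel hm, one_pow]
  linear_combination (-(m : ℝ) ^ #(univ.filter (fun x : V => x ∉ T))) * this

lemma union_bound (m : ℕ) [NeZero m] {β : Type*} (s : Finset β) (g : β → Finset V) (k : ℕ)
    (hg : ∀ b ∈ s, #(g b) = k) (N : ℝ) (hN : (#s : ℝ) ≤ N) :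
    (#(univ.filter (fun f : V → Fin m => ∃ b ∈ s, ∀ x ∈ g b, f x = 0)) : ℝ) ≤
      (m : ℝ) ^ Fintype.card V * (N * (1 / (m : ℝ)) ^ k) := by
  classical
  have h1 : univ.filter (fun f : V → Fin m => ∃ b ∈ s, ∀ x ∈ g b, f x = 0) ⊆
      s.biUnion (fun b => univ.filter (fun f : V → Fin m => ∀ x ∈ g b, f x = 0)) := by
    intro f hf
    simpa using hf
  have h2 := (card_le_card h1).trans card_biUnion_le
  have h3 : (#(univ.filter (fun f : V → Fin m => ∃ b ∈ s, ∀ x ∈ g b, f x = 0)) : ℝ) ≤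
      ∑ b ∈ s, (#(univ.filter (fun f : V → Fin m => ∀ x ∈ g b, f x = 0)) : ℝ) := by
    exact_mod_cast h2
  refine h3.trans ?_
  have h4 : ∀ b ∈ s, (#(univ.filter (fun f : V → Fin m => ∀ x ∈ g b, f x = 0)) : ℝ) =
      (m : ℝ) ^ Fintype.card V * (1 / (m : ℝ)) ^ k := by
    intro b hb
    rw [cnt_eq, hg b hb]
  rw [sum_congr rfl h4, sum_const, nsmul_eq_mul]
  have : 0 ≤ (m : ℝ) ^ Fintype.card V * (1 / (m : ℝ)) ^ k := by positivity
  nlinarith [mul_le_mul_of_nonneg_right hN this]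

lemma union_bound' (m : ℕ) [NeZero m] {β : Type*} (s : Finset β) (g : β → Finset V) (k : ℕ)
    (hg : ∀ b ∈ s, #(g b) = k) (N : ℝ) (hN : (#s : ℝ) ≤ N) :
    ∃ S : Finset (V → Fin m), (∀ f, (∃ b ∈ s, ∀ x ∈ g b, f x = 0) → f ∈ S) ∧ (#S : ℝ) ≤
      (m : ℝ) ^ Fintype.card V * (N * (1 / (m : ℝ)) ^ k) :=
  ⟨_, fun _ hf => mem_filter.2 ⟨mem_univ _, hf⟩, union_bound m s g k hg N hN⟩

omit [Fintype V] in
lemma card4 {a b c d : V} (h1 : a ≠ b) (h2 : a ≠ c) (h3 : a ≠ d) (h4 : b ≠ c) (h5 : b ≠ d)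
    (h6 : c ≠ d) : #({a, b, c, d} : Finset V) = 4 := by
  rw [card_insert_of_notMem (by simp [*]), card_insert_of_notMem (by simp [*]), card_pair h6]

omit [Fintype V] in
lemma card5 {a b c d e : V} (h1 : a ≠ b) (h2 : a ≠ c) (h3 : a ≠ d) (h4 : b ≠ c) (h5 : b ≠ d)
    (h6 : c ≠ d) (h7 : a ≠ e) (h8 : b ≠ e) (h9 : c ≠ e) (h10 : d ≠ e) :
    #({a, b, c, d, e} : Finset V) = 5 := by
  rw [card_insert_of_notMem (by simp [*]), card4 h4 h5 h8 h6 h9 h10]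

/-- forward neighbours -/
def Fw (W : Finset V) (o : V → ℕ) (x : V) : Finset V := W.filter (fun y => G.Adj x y ∧ o x < o y)

def P3 (W : Finset V) (o : V → ℕ) (x : V) : Finset (V × V) :=
  (Fw G W o x ×ˢ Fw G W o x).filter (fun p => G.Adj p.1 p.2)

def P4 (W : Finset V) (o : V → ℕ) (x : V) : Finset ((V × V) × V) :=
  ((Fw G W o x ×ˢ Fw G W o x) ×ˢ W).filter (fun p => p.1.1 ≠ p.1.2 ∧ ¬ G.Adj p.1.1 p.1.2 ∧
    G.Adj p.1.1 p.2 ∧ G.Adj p.1.2 p.2 ∧ o x < o p.2 ∧ ¬ G.Adj x p.2)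

def Bad (W : Finset V) (o : V → ℕ) {m : ℕ} [NeZero m] (f : V → Fin m) (x : V) : Prop :=
  (∃ p ∈ P3 G W o x, f p.1 = 0 ∧ f p.2 = 0) ∨
  (∃ p ∈ P4 G W o x, f p.1.1 = 0 ∧ f p.1.2 = 0 ∧ f p.2 = 0)

def Good (W : Finset V) (o : V → ℕ) {m : ℕ} [NeZero m] (f : V → Fin m) (x : V) : Prop :=
  f x = 0 ∧ ¬ Bad G W o f x

omit [Fintype V] in
lemma mem_Fw {W : Finset V} {o : V → ℕ} {x y : V} :
    y ∈ Fw G W o x ↔ y ∈ W ∧ G.Adj x y ∧ o x < o y := by simp [Fw]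

omit [Fintype V] in
lemma mem_P3 {W : Finset V} {o : V → ℕ} {x : V} {p : V × V} :
    p ∈ P3 G W o x ↔ (p.1 ∈ Fw G W o x ∧ p.2 ∈ Fw G W o x) ∧ G.Adj p.1 p.2 := by simp [P3]

omit [Fintype V] in
lemma mem_P4 {W : Finset V} {o : V → ℕ} {x : V} {p : (V × V) × V} :
    p ∈ P4 G W o x ↔ ((p.1.1 ∈ Fw G W o x ∧ p.1.2 ∈ Fw G W o x) ∧ p.2 ∈ W) ∧
      p.1.1 ≠ p.1.2 ∧ ¬ G.Adj p.1.1 p.1.2 ∧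
      G.Adj p.1.1 p.2 ∧ G.Adj p.1.2 p.2 ∧ o x < o p.2 ∧ ¬ G.Adj x p.2 := by
  simp [P4]

omit [Fintype V] in
lemma card_P3 (W : Finset V) (o : V → ℕ) (x : V) :
    #(P3 G W o x) = ∑ a ∈ Fw G W o x, #((Fw G W o x).filter (G.Adj a)) := by
  rw [P3, card_filter, sum_product]
  simp only [card_filter]

omit [Fintype V] in
lemma card_P4 (W : Finset V) (o : V → ℕ) (x : V) (D t : ℕ) (hF : #(Fw G W o x) ≤ D)
    (hco : ∀ a b, a ≠ b → ¬ G.Adj a b → ∀ F : Finset V,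
      #(F.filter (fun x => G.Adj a x ∧ G.Adj b x)) ≤ t) :
    #(P4 G W o x) ≤ D ^ 2 * t := by
  have h := card_le_mul_card_image_of_maps_to (s := P4 G W o x)
    (t := Fw G W o x ×ˢ Fw G W o x) (f := fun p => p.1)
    (by intro p hp; exact mem_product.2 ((mem_P4 G).1 hp).1.1) t (by
      rintro ⟨a, b⟩ _
      by_cases hab : a ≠ b ∧ ¬ G.Adj a b
      · refine le_trans ?_ (hco a b hab.1 hab.2 W)
        apply card_le_card_of_injOn (fun p => p.2)
        · rintro ⟨⟨a', b'⟩, w⟩ hp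
          simp only [coe_filter, Set.mem_ofPred_eq, Prod.mk.injEq, mem_P4] at hp
          obtain ⟨⟨⟨-, hw⟩, -, -, h1, h2, -⟩, rfl, rfl⟩ := hp
          simp [hw, h1, h2]
        · rintro ⟨⟨a', b'⟩, w⟩ hp ⟨⟨a'', b''⟩, w'⟩ hp' hw
          simp only [coe_filter, Set.mem_ofPred_eq, Prod.mk.injEq] at hp hp' hw
          simp [hp.2.1, hp.2.2, hp'.2.1, hp'.2.2, hw]
      · rw [card_eq_zero.2]
        · exact Nat.zero_le _
        · rw [filter_eq_empty_iff]
          rintro ⟨⟨a', b'⟩, w⟩ hp he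
          simp only [Prod.mk.injEq] at he
          obtain ⟨rfl, rfl⟩ := he
          have := (mem_P4 G).1 hp
          exact hab ⟨this.2.1, this.2.2.1⟩)
  rw [card_product] at h
  calc _ ≤ _ := h
    _ ≤ t * (D * D) := Nat.mul_le_mul_left _ (Nat.mul_le_mul hF hF)
    _ = _ := by ring

def P5 (W : Finset V) (o : V → ℕ) (x v : V) : Finset (V × V) :=
  (Fw G W o x ×ˢ W).filter (fun p => v ≠ p.1 ∧ ¬ G.Adj v p.1 ∧
    G.Adj v p.2 ∧ G.Adj p.1 p.2 ∧ o x < o p.2 ∧ ¬ G.Adj x p.2)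

omit [Fintype V] in
lemma card_P5 (W : Finset V) (o : V → ℕ) (x v : V) (D t : ℕ) (hF : #(Fw G W o x) ≤ D)
    (hco : ∀ a b, a ≠ b → ¬ G.Adj a b → ∀ F : Finset V,
      #(F.filter (fun x => G.Adj a x ∧ G.Adj b x)) ≤ t) :
    #(P5 G W o x v) ≤ D * t := by
  have h := card_le_mul_card_image_of_maps_to (s := P5 G W o x v)
    (t := Fw G W o x) (f := fun p => p.1)
    (by intro p hp; exact (mem_product.1 (mem_filter.1 hp).1).1) t (by
      intro b _
      by_cases hab : v ≠ b ∧ ¬ G.Adj v b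
      · refine le_trans ?_ (hco v b hab.1 hab.2 W)
        apply card_le_card_of_injOn (fun p => p.2)
        · rintro ⟨b', w⟩ hp
          simp only [coe_filter, Set.mem_ofPred_eq, P5, mem_filter, mem_product] at hp
          obtain ⟨⟨⟨-, hw⟩, -, -, h1, h2, -⟩, rfl⟩ := hp
          simp [hw, h1, h2]
        · rintro ⟨b', w⟩ hp ⟨b'', w'⟩ hp' hw
          simp only [coe_filter, Set.mem_ofPred_eq] at hp hp' hw
          simp [hp.2, hp'.2, hw]
      · rw [card_eq_zero.2]
        · exact Nat.zero_le _
        · rw [filter_eq_empty_iff]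
          rintro ⟨b', w⟩ hp rfl
          have := (mem_filter.1 hp).2
          exact hab ⟨this.1, this.2.1⟩)
  calc _ ≤ _ := h
    _ ≤ t * D := Nat.mul_le_mul_left _ hF
    _ = _ := by ring

open Classical in
lemma edge_bound (W : Finset V) (o : V → ℕ) (D t M m : ℕ) [NeZero m]
    (hF : ∀ u ∈ W, #(Fw G W o u) ≤ D)
    (hM : ∀ u ∈ W, #(P3 G W o u) ≤ M)
    (hco : ∀ a b, a ≠ b → ¬ G.Adj a b → ∀ F : Finset V,
      #(F.filter (fun x => G.Adj a x ∧ G.Adj b x)) ≤ t)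
    (u : V) (hu : u ∈ W) (v : V) (hv : v ∈ Fw G W o u) (q : ℝ) (hq : q = 1 / (m : ℝ)) :
    (m : ℝ) ^ Fintype.card V * (q ^ 2 - (M * q ^ 4 + #((Fw G W o u).filter (G.Adj v)) * q ^ 3 +
      M * q ^ 4 + (D ^ 2 * t) * q ^ 5 + (D * t) * q ^ 4 + (D ^ 2 * t) * q ^ 5)) ≤
    #(univ.filter (fun f : V → Fin m => Good G W o f u ∧ Good G W o f v)) := by
  subst hq
  obtain ⟨hvW, huv, houv⟩ := (mem_Fw G).1 hv
  have huv' : u ≠ v := G.ne_of_adj huv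
  have hno : ∀ {a b : V}, o a < o b → a ≠ b := fun h e => by rw [e] at h; exact lt_irrefl _ h
  have A0 := cnt_eq m ({u, v} : Finset V)
  rw [card_pair huv'] at A0
  obtain ⟨S1, H1, A1⟩ := union_bound' m ((P3 G W o u).filter (fun p => p.1 ≠ v ∧ p.2 ≠ v))
    (fun p => {u, v, p.1, p.2}) 4 (by
      rintro ⟨a, b⟩ hp
      obtain ⟨hp, h1, h2⟩ := mem_filter.1 hp
      obtain ⟨⟨ha, hb⟩, hab⟩ := (mem_P3 G).1 hp
      rw [mem_Fw] at ha hb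
      exact card4 huv' (hno ha.2.2) (hno hb.2.2) h1.symm h2.symm (G.ne_of_adj hab)) M
      (by exact_mod_cast (card_filter_le _ _).trans (hM u hu))
  obtain ⟨S2, H2, A2⟩ := union_bound' m ((Fw G W o u).filter (G.Adj v)) (fun b => {u, v, b}) 3 (by
      intro b hb
      obtain ⟨hb, hvb⟩ := mem_filter.1 hb
      rw [mem_Fw] at hb
      exact card_eq_three.2 ⟨u, v, b, huv', hno hb.2.2, G.ne_of_adj hvb, rfl⟩) _ le_rfl
  obtain ⟨S3, H3, A3⟩ := union_bound' m (P3 G W o v) (fun p => {u, v, p.1, p.2}) 4 (by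
      rintro ⟨a, b⟩ hp
      obtain ⟨⟨ha, hb⟩, hab⟩ := (mem_P3 G).1 hp
      rw [mem_Fw] at ha hb
      exact card4 huv' (hno (houv.trans ha.2.2)) (hno (houv.trans hb.2.2)) (hno ha.2.2)
        (hno hb.2.2) (G.ne_of_adj hab)) M (by exact_mod_cast hM v hvW)
  obtain ⟨S4, H4, A4⟩ := union_bound' m ((P4 G W o u).filter (fun p => p.1.1 ≠ v ∧ p.1.2 ≠ v))
    (fun p => {u, v, p.1.1, p.1.2, p.2}) 5 (by
      rintro ⟨⟨a, b⟩, w⟩ hp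
      obtain ⟨hp, h1, h2⟩ := mem_filter.1 hp
      obtain ⟨⟨⟨ha, hb⟩, hw⟩, hab, hab', haw, hbw, how, huw⟩ := (mem_P4 G).1 hp
      rw [mem_Fw] at ha hb
      refine card5 huv' (hno ha.2.2) (hno hb.2.2) h1.symm h2.symm hab (hno how) ?_
        (G.ne_of_adj haw) (G.ne_of_adj hbw)
      rintro rfl
      exact huw huv) (D ^ 2 * t) (by
        exact_mod_cast (card_filter_le _ _).trans (card_P4 G W o u D t (hF u hu) hco))
  obtain ⟨S5, H5, A5⟩ := union_bound' m (P5 G W o u v) (fun p => {u, v, p.1, p.2}) 4 (by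
      rintro ⟨b, w⟩ hp
      obtain ⟨hp, h1, h2, h3, h4, h5, h6⟩ := mem_filter.1 hp
      have hb := (mem_Fw G).1 (mem_product.1 hp).1
      exact card4 huv' (hno hb.2.2) (hno h5) h1 (G.ne_of_adj h3) (G.ne_of_adj h4))
      (D * t) (by exact_mod_cast card_P5 G W o u v D t (hF u hu) hco)
  obtain ⟨S6, H6, A6⟩ := union_bound' m (P4 G W o v)
    (fun p => {u, v, p.1.1, p.1.2, p.2}) 5 (by
      rintro ⟨⟨a, b⟩, w⟩ hp
      obtain ⟨⟨⟨ha, hb⟩, hw⟩, hab, hab', haw, hbw, how, huw⟩ := (mem_P4 G).1 hp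
      rw [mem_Fw] at ha hb
      exact card5 huv' (hno (houv.trans ha.2.2)) (hno (houv.trans hb.2.2)) (hno ha.2.2)
        (hno hb.2.2) hab (hno (houv.trans how)) (hno how)
        (G.ne_of_adj haw) (G.ne_of_adj hbw)) (D ^ 2 * t) (by
        exact_mod_cast card_P4 G W o v D t (hF v hvW) hco)
  set S0 := univ.filter (fun f : V → Fin m => ∀ x ∈ ({u, v} : Finset V), f x = 0)
  set SG := univ.filter (fun f : V → Fin m => Good G W o f u ∧ Good G W o f v) with hSG
  have hsub : S0 ⊆ SG ∪ (S1 ∪ (S2 ∪ (S3 ∪ (S4 ∪ (S5 ∪ S6))))) := by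
    intro f hf
    have hf' := (mem_filter.1 hf).2
    have fu : f u = 0 := hf' u (by simp)
    have fv : f v = 0 := hf' v (by simp)
    by_cases hg : Good G W o f u ∧ Good G W o f v
    · exact mem_union_left _ (mem_filter.2 ⟨mem_univ _, hg⟩)
    apply mem_union_right
    have hbad : Bad G W o f u ∨ Bad G W o f v := by
      by_contra hcon
      push Not at hcon
      exact hg ⟨⟨fu, hcon.1⟩, fv, hcon.2⟩
    simp only [mem_union]
    rcases hbad with (⟨⟨a, b⟩, hp, fa, fb⟩ | ⟨⟨⟨a, b⟩, w⟩, hp, fa, fb, fw⟩) |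
      (⟨⟨a, b⟩, hp, fa, fb⟩ | ⟨⟨⟨a, b⟩, w⟩, hp, fa, fb, fw⟩)
    · simp only at fa fb
      by_cases ha : a = v
      · subst ha
        right; left
        have := (mem_P3 G).1 hp
        exact H2 _ ⟨b, mem_filter.2 ⟨this.1.2, this.2⟩, by simp [fu, fa, fb]⟩
      by_cases hb : b = v
      · subst hb
        right; left
        have := (mem_P3 G).1 hp
        exact H2 _ ⟨a, mem_filter.2 ⟨this.1.1, this.2.symm⟩,
          by simp [fu, fa, fb]⟩
      left
      exact H1 _ ⟨(a, b), mem_filter.2 ⟨hp, ha, hb⟩, by simp [fu, fv, fa, fb]⟩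
    · simp only at fa fb fw
      obtain ⟨⟨⟨ha', hb'⟩, hw⟩, hab, hab', haw, hbw, how, huw⟩ := (mem_P4 G).1 hp
      simp only at ha' hb' hw hab hab' haw hbw how huw
      by_cases ha : a = v
      · subst ha
        right; right; right; right; left
        exact H5 _ ⟨(b, w), mem_filter.2 ⟨mem_product.2 ⟨hb', hw⟩,
          hab, hab', haw, hbw, how, huw⟩, by simp [fu, fa, fb, fw]⟩
      by_cases hb : b = v
      · subst hb
        right; right; right; right; left
        exact H5 _ ⟨(a, w), mem_filter.2 ⟨mem_product.2 ⟨ha', hw⟩,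
          hab.symm, fun h => hab' h.symm, hbw, haw, how, huw⟩, by simp [fu, fa, fb, fw]⟩
      right; right; right; left
      exact H4 _ ⟨((a, b), w), mem_filter.2 ⟨hp, ha, hb⟩,
        by simp [fu, fv, fa, fb, fw]⟩
    · simp only at fa fb
      right; right; left
      exact H3 _ ⟨(a, b), hp, by simp [fu, fv, fa, fb]⟩
    · simp only at fa fb fw
      right; right; right; right; right
      exact H6 _ ⟨((a, b), w), hp, by simp [fu, fv, fa, fb, fw]⟩
  have hc := card_le_card hsub
  have b1 := card_union_le SG (S1 ∪ (S2 ∪ (S3 ∪ (S4 ∪ (S5 ∪ S6)))))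
  have b2 := card_union_le S1 (S2 ∪ (S3 ∪ (S4 ∪ (S5 ∪ S6))))
  have b3 := card_union_le S2 (S3 ∪ (S4 ∪ (S5 ∪ S6)))
  have b4 := card_union_le S3 (S4 ∪ (S5 ∪ S6))
  have b5 := card_union_le S4 (S5 ∪ S6)
  have b6 := card_union_le S5 S6
  have hc' : #S0 ≤ #SG + (#S1 + (#S2 + (#S3 + (#S4 + (#S5 + #S6))))) := by omega
  have hc'' : (#S0 : ℝ) ≤ #SG + (#S1 + (#S2 + (#S3 + (#S4 + (#S5 + #S6))))) := by
    exact_mod_cast hc'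
  rw [A0] at hc''
  linarith

open Classical in
theorem sampling (W : Finset V) (o : V → ℕ) (D t M m : ℕ) [NeZero m]
    (hF : ∀ u ∈ W, #(Fw G W o u) ≤ D)
    (hM : ∀ u ∈ W, #(P3 G W o u) ≤ M)
    (hco : ∀ a b, a ≠ b → ¬ G.Adj a b → ∀ F : Finset V,
      #(F.filter (fun x => G.Adj a x ∧ G.Adj b x)) ≤ t)
    (hgood : ∀ f : V → Fin m,
      ∑ u ∈ W, #((Fw G W o u).filter (fun v => Good G W o f u ∧ Good G W o f v)) ≤
        2 * #(W.filter (fun x => f x = 0)))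
    (q : ℝ) (hq : q = 1 / (m : ℝ)) (e : ℝ) (he : e = ∑ u ∈ W, (#(Fw G W o u) : ℝ)) :
    e * (q ^ 2 - (2 * M * q ^ 4 + 2 * (D ^ 2 * t) * q ^ 5 + (D * t) * q ^ 4))
      - #W * M * q ^ 3 ≤ 2 * #W * q := by
  have hm : (0 : ℝ) < m := by exact_mod_cast Nat.pos_of_ne_zero (NeZero.ne m)
  have hqp : 0 < q := by rw [hq]; positivity
  set Z : ℝ := (m : ℝ) ^ Fintype.card V with hZ
  have hZp : 0 < Z := by positivity
  -- upper bound
  have hup : (∑ f : V → Fin m, (∑ u ∈ W,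
      (#((Fw G W o u).filter (fun v => Good G W o f u ∧ Good G W o f v)) : ℝ))) ≤
      2 * (#W * (Z * q)) := by
    calc _ ≤ ∑ f : V → Fin m, 2 * (#(W.filter (fun x => f x = 0)) : ℝ) := by
          apply sum_le_sum
          intro f _
          exact_mod_cast hgood f
      _ = 2 * ∑ x ∈ W, (#(univ.filter (fun f : V → Fin m => ∀ y ∈ ({x} : Finset V), f y = 0)) : ℝ)
          := by
          rw [← mul_sum]
          congr 1
          simp only [card_filter, Nat.cast_sum]
          rw [sum_comm]
          simp
      _ = 2 * ∑ x ∈ W, (Z * q) := by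
          congr 1
          apply sum_congr rfl
          intro x _
          rw [cnt_eq, card_singleton, pow_one, hq]
      _ = _ := by simp
  have hlow : (∑ f : V → Fin m, (∑ u ∈ W,
      (#((Fw G W o u).filter (fun v => Good G W o f u ∧ Good G W o f v)) : ℝ))) =
      ∑ u ∈ W, ∑ v ∈ Fw G W o u,
        (#(univ.filter (fun f : V → Fin m => Good G W o f u ∧ Good G W o f v)) : ℝ) := by
    rw [sum_comm]
    apply sum_congr rfl
    intro u _
    simp only [card_filter, Nat.cast_sum]
    rw [sum_comm]
  rw [hlow] at hup
  have hlow2 : ∑ u ∈ W, ∑ v ∈ Fw G W o u,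
      (Z * (q ^ 2 - (2 * M * q ^ 4 + 2 * (D ^ 2 * t) * q ^ 5 + (D * t) * q ^ 4))
        - Z * q ^ 3 * #((Fw G W o u).filter (G.Adj v))) ≤ 2 * (#W * (Z * q)) := by
    refine le_trans ?_ hup
    apply sum_le_sum
    intro u hu
    apply sum_le_sum
    intro v hv
    have := edge_bound G W o D t M m hF hM hco u hu v hv q hq
    refine le_trans (le_of_eq ?_) this
    ring
  have hP3 : ∑ u ∈ W, ∑ v ∈ Fw G W o u, Z * q ^ 3 * (#((Fw G W o u).filter (G.Adj v)) : ℝ) ≤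
      #W * (Z * q ^ 3 * M) := by
    rw [← nsmul_eq_mul, ← sum_const]
    apply sum_le_sum
    intro u hu
    rw [← mul_sum]
    apply mul_le_mul_of_nonneg_left _ (by positivity)
    have := hM u hu
    rw [card_P3] at this
    exact_mod_cast this
  simp only [sum_sub_distrib, sum_const, nsmul_eq_mul] at hlow2
  rw [← sum_mul, ← he] at hlow2
  have h := hlow2
  have : Z * (e * (q ^ 2 - (2 * M * q ^ 4 + 2 * (D ^ 2 * t) * q ^ 5 + (D * t) * q ^ 4))
      - #W * M * q ^ 3) ≤ Z * (2 * #W * q) := by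
    linarith
  exact le_of_mul_le_mul_left this hZp

end DP

namespace DP

open Finset

variable {V : Type*} [Fintype V] [DecidableEq V] (G : SimpleGraph V) [DecidableRel G.Adj]

omit [Fintype V] in
lemma no_tri_min {W : Finset V} {o : V → ℕ} {m : ℕ} [NeZero m] {f : V → Fin m} {a b c : V}
    (hb : b ∈ W) (hc : c ∈ W) (ga : Good G W o f a) (gb : Good G W o f b) (gc : Good G W o f c)
    (hab : G.Adj a b) (hbc : G.Adj b c) (hac : G.Adj a c) (oab : o a < o b) (oac : o a < o c) :
    False :=
  ga.2 (Or.inl ⟨(b, c), (mem_P3 G).2 ⟨⟨(mem_Fw G).2 ⟨hb, hab, oab⟩, (mem_Fw G).2 ⟨hc, hac, oac⟩⟩,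
    hbc⟩, gb.1, gc.1⟩)

omit [Fintype V] in
lemma no_c4_min {W : Finset V} {o : V → ℕ} {m : ℕ} [NeZero m] {f : V → Fin m} {a b c d : V}
    (hb : b ∈ W) (hc : c ∈ W) (hd : d ∈ W)
    (ga : Good G W o f a) (gb : Good G W o f b) (gc : Good G W o f c) (gd : Good G W o f d)
    (hbd : b ≠ d) (nac : ¬ G.Adj a c) (nbd : ¬ G.Adj b d)
    (hab : G.Adj a b) (hbc : G.Adj b c) (hcd : G.Adj c d) (hda : G.Adj d a)
    (oab : o a < o b) (oac : o a < o c) (oad : o a < o d) : False :=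
  ga.2 (Or.inr ⟨((b, d), c), (mem_P4 G).2 ⟨⟨⟨(mem_Fw G).2 ⟨hb, hab, oab⟩,
    (mem_Fw G).2 ⟨hd, hda.symm, oad⟩⟩, hc⟩, hbd, nbd, hbc, hcd.symm, oac, nac⟩, gb.1, gd.1, gc.1⟩)

open Classical in
lemma good_HD (hG : Paper.ThetaFree G) (W : Finset V) (o : V → ℕ) (ho : Set.InjOn o W)
    {m : ℕ} [NeZero m] (f : V → Fin m) : HD G 2 (W.filter (fun x => Good G W o f x)) := by
  intro S hS hne
  by_contra hcon
  push Not at hcon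
  have hW : ∀ x ∈ S, x ∈ W := fun x hx => (mem_filter.1 (hS hx)).1
  have hg : ∀ x ∈ S, Good G W o f x := fun x hx => (mem_filter.1 (hS hx)).2
  have hlt : ∀ x ∈ S, ∀ y ∈ S, x ≠ y → o x < o y ∨ o y < o x := by
    intro x hx y hy hxy
    exact lt_or_gt_of_ne (fun h => hxy (ho (hW x hx) (hW y hy) h))
  have htri : ∀ a ∈ S, ∀ b ∈ S, ∀ c ∈ S, G.Adj a b → G.Adj b c → G.Adj a c → False := by
    intro a ha b hb c hc hab hbc hac
    have h1 := hlt a ha b hb hab.ne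
    have h2 := hlt b hb c hc hbc.ne
    have h3 := hlt a ha c hc hac.ne
    have ga := hg a ha
    have gb := hg b hb
    have gc := hg c hc
    by_cases x1 : o a < o b
    · by_cases x2 : o a < o c
      · exact no_tri_min G (hW b hb) (hW c hc) ga gb gc hab hbc hac x1 x2
      · exact no_tri_min G (hW a ha) (hW b hb) gc ga gb hac.symm hab hbc.symm (by omega) (by omega)
    · by_cases x2 : o b < o c
      · exact no_tri_min G (hW a ha) (hW c hc) gb ga gc hab.symm hac hbc (by omega) (by omega)
      · exact no_tri_min G (hW a ha) (hW b hb) gc ga gb hac.symm hab hbc.symm (by omega) (by omega)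
  apply hG
  apply theta_of_girth5 G (S : Set V) (by exact_mod_cast hne)
  · intro a ha b hb c hc
    exact htri a (mem_coe.1 ha) b (mem_coe.1 hb) c (mem_coe.1 hc)
  · intro a ha b hb c hc d hd hac hbd hab hbc hcd hda
    rw [mem_coe] at ha hb hc hd
    have nac : ¬ G.Adj a c := fun h => htri a ha b hb c hc hab hbc h
    have nbd : ¬ G.Adj b d := fun h => htri b hb c hc d hd hbc hcd h
    have nca : ¬ G.Adj c a := fun h => nac h.symm
    have ndb : ¬ G.Adj d b := fun h => nbd h.symm
    have h1 := hlt a ha b hb hab.ne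
    have h2 := hlt b hb c hc hbc.ne
    have h3 := hlt c hc d hd hcd.ne
    have h4 := hlt d hd a ha hda.ne
    have h5 := hlt a ha c hc hac
    have h6 := hlt b hb d hd hbd
    have ga := hg a ha
    have gb := hg b hb
    have gc := hg c hc
    have gd := hg d hd
    have wa := hW a ha
    have wb := hW b hb
    have wc := hW c hc
    have wd := hW d hd
    have : (o a < o b ∧ o a < o c ∧ o a < o d) ∨ (o b < o c ∧ o b < o d ∧ o b < o a) ∨
      (o c < o d ∧ o c < o a ∧ o c < o b) ∨ (o d < o a ∧ o d < o b ∧ o d < o c) := by omega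
    rcases this with ⟨x, y, z⟩ | ⟨x, y, z⟩ | ⟨x, y, z⟩ | ⟨x, y, z⟩
    · exact no_c4_min G wb wc wd ga gb gc gd hbd nac nbd hab hbc hcd hda x y z
    · exact no_c4_min G wc wd wa gb gc gd ga hac.symm nbd nca hbc hcd hda hab x y z
    · exact no_c4_min G wd wa wb gc gd ga gb hbd.symm nca ndb hcd hda hab hbc x y z
    · exact no_c4_min G wa wb wc gd ga gb gc hac ndb nac hda hab hbc hcd x y z
  · intro u hu a
    have h := hcon u (mem_coe.1 hu)
    have h' : 1 < #((S.filter (G.Adj u)).erase a) := by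
      have := pred_card_le_card_erase (s := S.filter (G.Adj u)) (a := a)
      omega
    obtain ⟨b, hb, c, hc, hbc⟩ := one_lt_card.1 h'
    obtain ⟨hba, hb⟩ := mem_erase.1 hb
    obtain ⟨hca, hc⟩ := mem_erase.1 hc
    rw [mem_filter] at hb hc
    exact ⟨b, hb.1, c, hc.1, hbc, hba, hca, hb.2, hc.2⟩

open Classical in
lemma good_bound (hG : Paper.ThetaFree G) (W : Finset V) (o : V → ℕ) (ho : Set.InjOn o W)
    {m : ℕ} [NeZero m] (f : V → Fin m) :
    ∑ u ∈ W, #((Fw G W o u).filter (fun v => Good G W o f u ∧ Good G W o f v)) ≤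
        2 * #(W.filter (fun x => f x = 0)) := by
  set U := W.filter (fun x => Good G W o f x) with hU
  have h1 := sum_deg_le G 2 U (good_HD G hG W o ho f)
  rw [sum_deg_order G U o (ho.mono (by intro x hx; exact (mem_filter.1 hx).1))] at h1
  have h2 : #U ≤ #(W.filter (fun x => f x = 0)) := by
    apply card_le_card
    intro x hx
    rw [hU, mem_filter] at hx
    exact mem_filter.2 ⟨hx.1, hx.2.1⟩
  have h3 : ∑ u ∈ W, #((Fw G W o u).filter (fun v => Good G W o f u ∧ Good G W o f v)) ≤
      ∑ u ∈ U, #(U.filter (fun v => G.Adj u v ∧ o u < o v)) := by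
    rw [hU, sum_filter]
    apply sum_le_sum
    intro u hu
    split_ifs with h
    · apply card_le_card
      intro v hv
      rw [mem_filter, mem_Fw] at hv
      exact mem_filter.2 ⟨mem_filter.2 ⟨hv.1.1, hv.2.2⟩, hv.1.2⟩
    · simp [h]
  omega

lemma numerics (r T t n e q : ℝ) (hT : 1 ≤ T) (ht : t ≤ T) (ht0 : 0 ≤ t) (hn : 0 < n)
    (hr : 8 * (1024 * T) + 1 ≤ r) (he : n * r ^ 4 ≤ 2 * e)
    (hq : q = 1 / (1024 * T * r ^ 3))
    (h : e * (q ^ 2 - (2 * (64 * r ^ 6 * T) * q ^ 4 + 2 * ((16 * r ^ 4) ^ 2 * t) * q ^ 5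
      + ((16 * r ^ 4) * t) * q ^ 4)) - n * (64 * r ^ 6 * T) * q ^ 3 ≤ 2 * n * q) : False := by
  have hr1 : 1 ≤ r := by nlinarith
  have hr0 : 0 < r := by linarith
  have hT0 : 0 < T := by linarith
  have hm0 : 0 < 1024 * T * r ^ 3 := by positivity
  have hq0 : 0 < q := by rw [hq]; positivity
  have e0 : 0 ≤ e := by
    have : 0 ≤ n * r ^ 4 := by positivity
    linarith
  have k1 : q * (1024 * T * r ^ 3) = 1 := by rw [hq]; field_simp
  have k1' : q * r ^ 3 * T = 1 / 1024 := by linarith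
  have k2 : 64 * r ^ 6 * T * q = r ^ 3 / 16 := by linear_combination (64 * r ^ 3) * k1'
  have qr : q * r ^ 3 ≤ 1 / 1024 := by
    have : 0 ≤ q * r ^ 3 := by positivity
    nlinarith
  have k3 : 64 * r ^ 6 * T * q ^ 2 ≤ 1 / 16 := by
    have : 64 * r ^ 6 * T * q ^ 2 = (q * r ^ 3) / 16 := by linear_combination q * k2
    linarith
  have q1 : q ≤ 1 / 1024 := by
    have : 1 ≤ r ^ 3 := one_le_pow₀ hr1
    nlinarith
  have qt : q * r ^ 3 * t ≤ 1 / 1024 := by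
    have := mul_le_mul_of_nonneg_left ht (by positivity : 0 ≤ q * r ^ 3)
    linarith
  have qt0 : 0 ≤ q * r ^ 3 * t := by positivity
  have k4 : (16 * r ^ 4) * t * q ^ 2 ≤ 1 / 16 := by
    have : (16 * r ^ 4) * t * q ^ 2 = 16 * (q * r ^ 3 * t) * (q * r) := by ring
    have hqr : q * r ≤ 1 / 1024 := by
      have : r ≤ r ^ 3 := by
        have := pow_le_pow_right₀ hr1 (by norm_num : 1 ≤ 3)
        simpa using this
      have := mul_le_mul_of_nonneg_left this hq0.le
      linarith
    have hqr0 : 0 ≤ q * r := by positivity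
    nlinarith
  have k5 : (16 * r ^ 4) ^ 2 * t * q ^ 3 ≤ 1 / 16 := by
    have h1 : (16 * r ^ 4) ^ 2 * t * q ^ 3 = 256 * ((q * r ^ 3 * t) * ((q * r ^ 3) * (q * r ^ 2))) := by
      ring
    have hqr : q * r ^ 2 ≤ 1 / 1024 := by
      have : r ^ 2 ≤ r ^ 3 := pow_le_pow_right₀ hr1 (by norm_num)
      have := mul_le_mul_of_nonneg_left this hq0.le
      linarith
    have a0 : 0 ≤ q * r ^ 2 := by positivity
    have b0 : 0 ≤ q * r ^ 3 := by positivity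
    have h2 : (q * r ^ 3) * (q * r ^ 2) ≤ (1 / 1024) * (1 / 1024) :=
      mul_le_mul qr hqr a0 (by norm_num)
    have h3 : (q * r ^ 3 * t) * ((q * r ^ 3) * (q * r ^ 2)) ≤ (1 / 1024) * ((1 / 1024) * (1 / 1024)) :=
      mul_le_mul qt h2 (by positivity) (by norm_num)
    rw [h1]
    linarith
  set E := 1 - (2 * (64 * r ^ 6 * T * q ^ 2) + 2 * ((16 * r ^ 4) ^ 2 * t * q ^ 3)
      + (16 * r ^ 4) * t * q ^ 2) with hE
  have hE5 : 5 / 8 ≤ E := by rw [hE]; linarith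
  set m := 1024 * T * r ^ 3 with hm
  have h' : q ^ 2 * (e * E - n * (r ^ 3 / 16)) ≤ q ^ 2 * (2 * n * m) := by
    have l : q ^ 2 * (e * E - n * (r ^ 3 / 16)) = e * (q ^ 2 - (2 * (64 * r ^ 6 * T) * q ^ 4 +
      2 * ((16 * r ^ 4) ^ 2 * t) * q ^ 5
      + ((16 * r ^ 4) * t) * q ^ 4)) - n * (64 * r ^ 6 * T) * q ^ 3 := by
      rw [hE, ← k2]; ring
    have l2 : q ^ 2 * (2 * n * m) = 2 * n * q := by linear_combination 2 * n * q * k1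
    rw [l, l2]; exact h
  have h2 := le_of_mul_le_mul_left h' (by positivity)
  have h3 : e * (5 / 8) ≤ e * E := mul_le_mul_of_nonneg_left hE5 e0
  have h4 : n * r ^ 3 * (r * (5 / 16)) ≤ n * r ^ 3 * (1 / 16 + 2048 * T) := by
    rw [hm] at h2
    nlinarith
  have h5 := le_of_mul_le_mul_left h4 (by positivity)
  linarith

lemma no_dense (hG : Paper.ThetaFree G) (w t r : ℕ)
    (hcl : ∀ T : Finset V, G.IsClique (T : Set V) → #T ≤ w)
    (hco : ∀ a b, a ≠ b → ¬ G.Adj a b → ∀ F : Finset V,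
      #(F.filter (fun x => G.Adj a x ∧ G.Adj b x)) ≤ t)
    (hwt : w ≤ t + 1) (hr : 8 * (1024 * (t + 1)) + 1 ≤ r)
    (W : Finset V) (hne : W.Nonempty) (hmin : ∀ u ∈ W, r ^ 4 ≤ #(W.filter (G.Adj u)))
    (hHD : HD G (16 * r ^ 4) W) : False := by
  obtain ⟨o, ho, hf⟩ := exists_order G _ W hHD
  have hr0 : 0 < r := by omega
  have hm0 : 1024 * (t + 1) * r ^ 3 ≠ 0 := by positivity
  haveI : NeZero (1024 * (t + 1) * r ^ 3) := ⟨hm0⟩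
  have hF : ∀ u ∈ W, #(Fw G W o u) ≤ 16 * r ^ 4 := hf
  have hM : ∀ u ∈ W, #(P3 G W o u) ≤ 64 * r ^ 6 * (t + 1) := by
    intro u hu
    have h := e2_bound G w t hcl hco (Fw G W o u)
    rw [← card_P3] at h
    refine (Nat.pow_le_pow_iff_left (n := 2) (by norm_num)).1 ?_
    calc _ ≤ _ := h
      _ ≤ (t + 1) * (t + 1) * (16 * r ^ 4) ^ 3 := by
        gcongr
        exact hF u hu
      _ = _ := by ring
  have hs := sampling G W o (16 * r ^ 4) t (64 * r ^ 6 * (t + 1)) (1024 * (t + 1) * r ^ 3) hF hM hco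
    (by
      intro f
      have := good_bound G hG W o ho f
      convert this) _ rfl _ rfl
  have hd := sum_deg_order G W o ho
  have hd2 : #W * r ^ 4 ≤ 2 * ∑ u ∈ W, #(Fw G W o u) := by
    calc #W * r ^ 4 = ∑ u ∈ W, r ^ 4 := by simp
      _ ≤ _ := sum_le_sum hmin
      _ = _ := hd
  have hd3 : (#W : ℝ) * (r : ℝ) ^ 4 ≤ 2 * ∑ u ∈ W, (#(Fw G W o u) : ℝ) := by exact_mod_cast hd2
  refine numerics r (t + 1) t #W (∑ u ∈ W, (#(Fw G W o u) : ℝ)) _ (by simp) (by simp) (by simp)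
    (by exact_mod_cast hne.card_pos) (by exact_mod_cast hr) hd3 rfl ?_
  push_cast at hs
  exact hs

lemma degen (hG : Paper.ThetaFree G) (w t : ℕ)
    (hcl : ∀ T : Finset V, G.IsClique (T : Set V) → #T ≤ w)
    (hco : ∀ a b, a ≠ b → ¬ G.Adj a b → ∀ F : Finset V,
      #(F.filter (fun x => G.Adj a x ∧ G.Adj b x)) ≤ t)
    (hwt : w ≤ t + 1) : HD G ((8 * (1024 * (t + 1)) + 1) ^ 4) univ := by
  intro S _ hS
  by_contra hcon
  push Not at hcon
  set Q : ℕ → Prop := fun r => ∃ W : Finset V, W.Nonempty ∧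
    ∀ u ∈ W, r ^ 4 ≤ #(W.filter (G.Adj u)) with hQ
  have hQ0 : Q (8 * (1024 * (t + 1)) + 1) := ⟨S, hS, fun u hu => (hcon u hu).le⟩
  have hQb : ∀ r, Q r → r ≤ Fintype.card V := by
    rintro r ⟨W, ⟨u, hu⟩, h⟩
    calc r ≤ r ^ 4 := Nat.le_self_pow (by norm_num) r
      _ ≤ _ := h u hu
      _ ≤ _ := card_le_univ _
  classical
  set r := Nat.findGreatest Q (Fintype.card V) with hr
  have h1 : Q r := Nat.findGreatest_spec (hQb _ hQ0) hQ0
  have h2 : 8 * (1024 * (t + 1)) + 1 ≤ r := Nat.le_findGreatest (hQb _ hQ0) hQ0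
  have h3 : ¬ Q (r + 1) := by
    intro h
    have := Nat.le_findGreatest (hQb _ h) h
    omega
  obtain ⟨W, hne, hmin⟩ := h1
  refine no_dense G hG w t r hcl hco hwt h2 W hne hmin ?_
  intro S' _ hS'
  by_contra hc
  push Not at hc
  apply h3
  refine ⟨S', hS', fun u hu => ?_⟩
  have : (r + 1) ^ 4 ≤ (2 * r) ^ 4 := Nat.pow_le_pow_left (by omega) 4
  have e : (2 * r) ^ 4 = 16 * r ^ 4 := by ring
  have := hc u hu
  omega

lemma codeg (hG : Paper.ThetaFree G) (w : ℕ)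
    (hcl : ∀ T : Finset V, G.IsClique (T : Set V) → #T ≤ w) :
    ∀ a b, a ≠ b → ¬ G.Adj a b → ∀ F : Finset V,
      #(F.filter (fun x => G.Adj a x ∧ G.Adj b x)) ≤ (w + 1) ^ 2 := by
  intro a b hab hn F
  apply ramsey3 G w
  · intro x hx y hy z hz hxy hxz hyz nxy nxz nyz
    simp only [mem_filter] at hx hy hz
    refine no_common_triple G hG a b hab hn ![x, y, z] ?_ ?_ ?_
    · intro i j hij
      fin_cases i <;> fin_cases j <;>
        simp_all [G.adj_comm, Ne.symm hxy, Ne.symm hxz, Ne.symm hyz]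
    · intro i
      fin_cases i <;> simp_all
    · intro i
      fin_cases i <;> simp_all
  · intro T _ hT
    exact hcl T hT

end DP

/-- Degenerate partition for theta-free graphs: a partition into at most
`p(ω) · log n` independent sets, each vertex having at most `p(ω)` neighbors among
the not-yet-removed vertices. -/
theorem degenerate_partition :
    ∃ p : Polynomial ℕ, ∀ (V : Type) [Fintype V] (G : SimpleGraph V),
      Paper.ThetaFree G → 2 ≤ Fintype.card V →
      ∃ (k : ℕ) (S : Fin k → Finset V),
        (∀ v : V, ∃! i, v ∈ S i) ∧
        ((k : ℝ) ≤ ((p.eval G.cliqueNum : ℕ) : ℝ) * Real.logb 2 (Fintype.card V)) ∧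
        (∀ i, Paper.IsIndep G ↑(S i)) ∧
        (∀ i : Fin k, ∀ v ∈ S i,
          ({u | G.Adj v u ∧ ∀ j : Fin k, j < i → u ∉ S j}).ncard ≤
            p.eval G.cliqueNum) := by
  classical
  refine ⟨4 * (8 * (1024 * ((Polynomial.X + 1) ^ 2 + 1)) + 1) ^ 4 + 2, ?_⟩
  intro V _ G hG hV
  set w := G.cliqueNum with hw
  set P : ℕ := (8 * (1024 * ((w + 1) ^ 2 + 1)) + 1) ^ 4 with hP
  have hev : (4 * (8 * (1024 * ((Polynomial.X + 1) ^ 2 + 1)) + 1) ^ 4 + 2 : Polynomial ℕ).eval w =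
      4 * P + 2 := by
    simp [hP]
  rw [hev]
  have hcl : ∀ T : Finset V, G.IsClique (T : Set V) → T.card ≤ w :=
    fun T hT => hT.card_le_cliqueNum
  have hHD : DP.HD G P Finset.univ :=
    DP.degen G hG w ((w + 1) ^ 2) hcl (DP.codeg G hG w hcl) (by nlinarith)
  clear_value P
  set s := Nat.log 2 (Fintype.card V) + 1 with hs
  obtain ⟨r, hr1, hr2, hr3⟩ := DP.exists_rank G P s Finset.univ hHD
    (by rw [Finset.card_univ]; exact Nat.lt_pow_succ_log_self (by norm_num) _)
  refine ⟨(P + 1) * s, fun i => Finset.univ.filter (fun v => r v = i), ?_, ?_, ?_, ?_⟩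
  · intro v
    refine ⟨⟨r v, hr1 v (Finset.mem_univ _)⟩, by simp, ?_⟩
    intro i hi
    ext
    simp at hi
    exact hi.symm
  · have h1 : (1 : ℝ) ≤ Real.logb 2 (Fintype.card V) := by
      rw [Real.le_logb_iff_rpow_le (by norm_num) (by positivity)]
      simpa using (by exact_mod_cast hV : (2 : ℝ) ≤ (Fintype.card V : ℝ))
    have h2 : (Nat.log 2 (Fintype.card V) : ℝ) ≤ Real.logb 2 (Fintype.card V) := by
      have := Real.natLog_le_logb (Fintype.card V) 2
      exact_mod_cast this
    have h3 : (s : ℝ) ≤ 2 * Real.logb 2 (Fintype.card V) := by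
      rw [hs]; push_cast; linarith
    push_cast
    have hP0 : (0 : ℝ) ≤ P := by positivity
    have := mul_le_mul_of_nonneg_left h3 (by positivity : (0 : ℝ) ≤ (P : ℝ) + 1)
    nlinarith
  · intro i a ha b hb hab hadj
    simp at ha hb
    exact hr2 a (Finset.mem_univ _) b (Finset.mem_univ _) hadj (by rw [ha, hb])
  · intro i v hv
    simp only [Finset.mem_filter, Finset.mem_univ, true_and] at hv
    have h := hr3 v (Finset.mem_univ _)
    have hsub : {u | G.Adj v u ∧ ∀ j : Fin ((P + 1) * s), j < i →
        u ∉ Finset.univ.filter (fun v => r v = j)} ⊆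
        ((Finset.univ.filter (fun u => G.Adj v u ∧ r v ≤ r u) : Finset V) : Set V) := by
      rintro u ⟨hu, hj⟩
      simp only [Finset.coe_filter, Finset.mem_univ, true_and, Set.mem_ofPred_eq]
      refine ⟨hu, ?_⟩
      by_contra hlt
      push Not at hlt
      refine hj ⟨r u, hr1 u (Finset.mem_univ _)⟩ ?_ (by simp)
      rw [Fin.lt_def]
      simp only
      omega
    have h2 := Set.ncard_le_ncard hsub (Finset.finite_toSet _)
    rw [Set.ncard_coe_finset] at h2
    exact h2.trans (h.trans (by omega))
end
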